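/- arXiv:1804.04594 — 3 statements merged into one kernel-verified Lean document; each statement's English description precedes it below -/
import Mathlib

section
/- Let B be a finite group acting fixed-point-freely on a nontrivial finite group A (every nonidentity element of B fixes only the identity of A). Then any subgroup of B of order p*q, where p and q are primes, is cyclic. -/
theorem aux_surj {G A : Type*} [Group G] [Group A] [Finite A] [MulDistribMulAction G A]
    (h : G) (hf : ∀ a : A, h • a = a → a = 1) (K : Subgroup A) (hK : ∀ k ∈ K, h • k ∈ K) :
    ∀ k ∈ K, ∃ n ∈ K, n⁻¹ * h • n = k := by
  let f : K → K := fun n => ⟨(n : A)⁻¹ * h • (n : A), K.mul_mem (K.inv_mem n.2) (hK _ n.2)⟩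
  have hinj : Function.Injective f := by
    intro a b hab
    have h1 : (a : A)⁻¹ * h • (a : A) = (b : A)⁻¹ * h • (b : A) := congrArg Subtype.val hab
    have h2 : h • ((b : A) * (a : A)⁻¹) = (b : A) * (a : A)⁻¹ := by
      rw [smul_mul', smul_inv']
      have : h • (a : A) = a * ((b : A)⁻¹ * h • (b : A)) := by rw [← h1]; group
      rw [this]; group
    have h3 := hf _ h2
    exact Subtype.ext (mul_inv_eq_one.mp h3).symm
  intro k hk
  obtain ⟨n, hn⟩ := Finite.surjective_of_injective hinj ⟨k, hk⟩
  exact ⟨n, n.2, congrArg Subtype.val hn⟩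

theorem aux_smul {G A : Type*} [Group G] [Group A] [MulDistribMulAction G A] (r : ℕ)
    (h : G) (a : A) (R : Sylow r A) : h • (a • R) = (h • a) • (h • R) := by
  apply Sylow.ext
  ext x
  simp only [Sylow.coe_subgroup_smul, Sylow.pointwise_smul_def,
    Subgroup.mem_pointwise_smul_iff_inv_smul_mem]
  simp [smul_mul']

theorem aux_exists {G A : Type*} [Group G] [Group A] [Finite A] [MulDistribMulAction G A]
    (h : G) (hf : ∀ a : A, h • a = a → a = 1) (r : ℕ) [Fact r.Prime] :
    ∃ R : Sylow r A, h • R = R := by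
  obtain ⟨R⟩ : Nonempty (Sylow r A) := inferInstance
  obtain ⟨g, hg⟩ := MulAction.exists_smul_eq A R (h • R)
  obtain ⟨n, -, hn⟩ := aux_surj h hf ⊤ (fun _ _ => trivial) g⁻¹ trivial
  refine ⟨n • R, ?_⟩
  rw [aux_smul, ← hg, smul_smul]
  congr 1
  have : h • n = n * g⁻¹ := by rw [← hn]; group
  rw [this]; group

theorem aux_unique {G A : Type*} [Group G] [Group A] [Finite A] [MulDistribMulAction G A]
    (h : G) (hf : ∀ a : A, h • a = a → a = 1) (r : ℕ) [Fact r.Prime]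
    (R S : Sylow r A) (hR : h • R = R) (hS : h • S = S) : S = R := by
  obtain ⟨g, rfl⟩ := MulAction.exists_smul_eq A R S
  rw [aux_smul, hR] at hS
  have hK : ∀ k ∈ MulAction.stabilizer A R, h • k ∈ MulAction.stabilizer A R := by
    intro k hk
    rw [MulAction.mem_stabilizer_iff] at *
    conv_lhs => rw [← hR, ← aux_smul, hk, hR]
  obtain ⟨n, hn, hn2⟩ := aux_surj h hf (MulAction.stabilizer A R) hK (g⁻¹ * h • g) (by
    rw [MulAction.mem_stabilizer_iff, mul_smul, hS, inv_smul_smul])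
  have h2 : h • (g * n⁻¹) = g * n⁻¹ := by
    rw [smul_mul', smul_inv']
    have : h • n = n * (g⁻¹ * h • g) := by rw [← hn2]; group
    rw [this]; group
  have h3 := mul_inv_eq_one.mp (hf _ h2)
  rw [h3]; exact hn

theorem aux_invSylow {G A : Type*} [Group G] [Group A] [Finite A] [MulDistribMulAction G A]
    (hf : ∀ h : G, h ≠ 1 → ∀ a : A, h • a = a → a = 1) (r : ℕ) [Fact r.Prime]
    (x : G) (hx : x ≠ 1) (hN : (Subgroup.zpowers x).Normal) :
    ∃ R : Sylow r A, ∀ g : G, g • R = R := by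
  obtain ⟨R, hR⟩ := aux_exists x (hf x hx) r
  refine ⟨R, fun g => ?_⟩
  apply aux_unique x (hf x hx) r R _ hR
  have h1 : g⁻¹ * x * g⁻¹⁻¹ ∈ Subgroup.zpowers x := hN.conj_mem x (Subgroup.mem_zpowers x) g⁻¹
  have h2 : Subgroup.zpowers x ≤ MulAction.stabilizer G R := by
    rw [Subgroup.zpowers_le]; exact hR
  have h3 : (g⁻¹ * x * g⁻¹⁻¹) • R = R := h2 h1
  calc x • g • R = g • (g⁻¹ * x * g⁻¹⁻¹) • R := by
        rw [smul_smul, smul_smul]; congr 1; group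
    _ = g • R := by rw [h3]

theorem aux_prod_range {G V : Type*} [Group G] [CommGroup V] [MulDistribMulAction G V]
    (hf : ∀ h : G, h ≠ 1 → ∀ a : V, h • a = a → a = 1)
    (x : G) (hx : x ≠ 1) (n : ℕ) (hn : x ^ n = 1) (v : V) :
    ∏ i ∈ Finset.range n, x ^ i • v = 1 := by
  apply hf x hx
  rw [Finset.smul_prod']
  have h1 := Finset.prod_range_succ (fun i => x ^ i • v) n
  have h2 := Finset.prod_range_succ' (fun i => x ^ i • v) n
  rw [h1] at h2
  simp only [hn, pow_zero, one_smul] at h2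
  rw [mul_right_cancel h2]
  simp [smul_smul, pow_succ']

/-- Key counting step. -/
theorem aux_key {G V : Type*} [Group G] [CommGroup V] [MulDistribMulAction G V]
    [Finite G]
    (hf : ∀ h : G, h ≠ 1 → ∀ a : V, h • a = a → a = 1)
    (p : ℕ) (hp : p.Prime) (N : Subgroup G) [N.Normal] (hN1 : N ≠ ⊥) (y : G) 
    (hyN : ∀ n ∈ N, (n * y) ≠ 1) (hy : ∀ n ∈ N, (n * y) ^ p = 1) (v : V) :
    v ^ Nat.card N = 1 := by
  classical
  have : Fintype N := Fintype.ofFinite N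
  have hNsum : ∀ w : V, ∏ n : N, (n : G) • w = 1 := by
    intro w
    obtain ⟨m, hm, hm1⟩ := (Subgroup.ne_bot_iff_exists_ne_one (H := N)).mp hN1 |>.elim
      (fun a ha => (⟨a, a.2, fun h => ha (Subtype.ext h)⟩ : ∃ m : G, m ∈ N ∧ m ≠ 1))
    apply hf m hm1
    rw [Finset.smul_prod']
    refine Fintype.prod_equiv (Equiv.mulLeft (⟨m, hm⟩ : N)) _ _ ?_
    intro a
    simp [smul_smul]
  have h1 : ∏ n : N, ∏ j ∈ Finset.range p, ((n : G) * y) ^ j • v = 1 :=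
    Finset.prod_eq_one fun n _ => aux_prod_range hf _ (hyN n n.2) p (hy n n.2) v
  rw [Finset.prod_comm] at h1
  rw [Finset.prod_eq_single 0] at h1
  · simpa [Nat.card_eq_fintype_card] using h1
  · intro j hj hj0
    have hjp : j.Coprime p := by
      rw [Nat.coprime_comm]
      exact Nat.coprime_of_lt_prime hj0 (Finset.mem_range.mp hj) hp
    have hmem : ∀ n : N, ((n : G) * y) ^ j * (y ^ j)⁻¹ ∈ N := by
      intro n
      rw [← QuotientGroup.eq_one_iff]
      have : ((n : G) : G ⧸ N) = 1 := (QuotientGroup.eq_one_iff _).mpr n.2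
      simp [this]
    let f : N → N := fun n => ⟨_, hmem n⟩
    have finj : Function.Injective f := by
      intro a b hab
      have e1 : ((a : G) * y) ^ j = ((b : G) * y) ^ j :=
        mul_right_cancel (congrArg Subtype.val hab)
      have e2 : ((a : G) * y) = ((b : G) * y) := by
        have key : ∀ c : G, c ^ p = 1 → c = (c ^ j) ^ (Nat.gcdA j p) := by
          intro c hc
          have := Nat.gcd_eq_gcd_ab j p
          rw [hjp] at this
          calc c = c ^ ((1 : ℕ) : ℤ) := by simp
            _ = _ := by rw [this, zpow_add, zpow_mul, zpow_mul, zpow_natCast, zpow_natCast, hc]; simp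
        rw [key _ (hy a a.2), key _ (hy b b.2), e1]
      exact Subtype.ext (mul_right_cancel e2)
    have fbij : Function.Bijective f := Finite.injective_iff_bijective.mp finj
    rw [← hNsum (y ^ j • v)]
    refine Fintype.prod_bijective f fbij _ _ ?_
    intro n
    simp [f, smul_smul]
  · intro h; exact absurd (Finset.mem_range.mpr hp.pos) h

theorem aux_main {G A : Type*} [Group G] [Group A] [Finite A] [Finite G] [Nontrivial A]
    [MulDistribMulAction G A]
    (hf : ∀ h : G, h ≠ 1 → ∀ a : A, h • a = a → a = 1)
    (p q : ℕ) (hp : p.Prime) (hq : q.Prime) (hpq : p ≤ q) (hG : Nat.card G = p * q) :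
    IsCyclic G := by
  by_contra hcyc
  have : Fact p.Prime := ⟨hp⟩
  have : Fact q.Prime := ⟨hq⟩
  obtain ⟨x, hx⟩ := exists_prime_orderOf_dvd_card' (G := G) q (hG ▸ Dvd.intro_left p rfl)
  have hx1 : x ≠ 1 := by
    rintro rfl
    rw [orderOf_one] at hx
    exact hq.one_lt.ne hx
  have hcard : Nat.card (Subgroup.zpowers x) = q := by rw [Nat.card_zpowers, hx]
  have hidx : (Subgroup.zpowers x).index = p := by
    have := (Subgroup.zpowers x).card_mul_index
    rw [hcard, hG, mul_comm] at this
    exact Nat.eq_of_mul_eq_mul_right hq.pos this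
  have hN : (Subgroup.zpowers x).Normal := by
    apply Subgroup.normal_of_index_eq_minFac_card
    rw [hidx, hG]
    have hne : p * q ≠ 1 := fun h => hp.ne_one (Nat.eq_one_of_mul_eq_one_right h)
    apply le_antisymm
    · have hm := Nat.minFac_prime hne
      rcases hm.dvd_mul.mp (Nat.minFac_dvd (p * q)) with h | h
      · exact ((Nat.prime_dvd_prime_iff_eq hm hp).mp h).ge
      · exact hpq.trans ((Nat.prime_dvd_prime_iff_eq hm hq).mp h).ge
    · exact Nat.minFac_le_of_dvd hp.two_le (Dvd.intro q rfl)
  -- an element outside, of order p together with its coset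
  obtain ⟨y, hyN, hyp⟩ : ∃ y : G, (∀ n ∈ Subgroup.zpowers x, n * y ≠ 1) ∧
      ∀ n ∈ Subgroup.zpowers x, (n * y) ^ p = 1 := by
    obtain ⟨y, hy⟩ : ∃ y, y ∉ Subgroup.zpowers x := by
      by_contra hcon
      push Not at hcon
      exact hcyc ⟨x, hcon⟩
    have hout : ∀ n ∈ Subgroup.zpowers x, n * y ∉ Subgroup.zpowers x := fun n hn h =>
      hy ((Subgroup.mul_mem_cancel_left _ hn).mp h)
    refine ⟨y, fun n hn h => hout n hn (h ▸ Subgroup.one_mem _), fun n hn => ?_⟩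
    set z := n * y
    have hz := hout n hn
    -- z ^ p ∈ N
    have hzp : z ^ p ∈ Subgroup.zpowers x := by
      have := Subgroup.pow_index_mem (Subgroup.zpowers x) z
      rwa [hidx] at this
    have hNq : ∀ m ∈ Subgroup.zpowers x, m ^ q = 1 := by
      intro m hm
      obtain ⟨k, rfl⟩ := hm
      simp only
      rw [← zpow_natCast, ← zpow_mul, mul_comm, zpow_mul, zpow_natCast, ← hx, pow_orderOf_eq_one,
        one_zpow]
    by_contra hne
    -- order of z ^ p is q
    have ho : orderOf (z ^ p) = q := orderOf_eq_prime (hNq _ hzp) hne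
    apply hcyc
    have hle : Subgroup.zpowers (z ^ p) = Subgroup.zpowers x := by
      apply Subgroup.eq_of_le_of_card_ge
      · rwa [Subgroup.zpowers_le]
      · rw [hcard, Nat.card_zpowers, ho]
    have hxz : Subgroup.zpowers x ≤ Subgroup.zpowers z := by
      rw [← hle, Subgroup.zpowers_le]
      exact Subgroup.pow_mem _ (Subgroup.mem_zpowers z) p
    have hd : q ∣ orderOf z := by
      rw [← hx, ← Nat.card_zpowers, ← Nat.card_zpowers]
      exact Subgroup.card_dvd_of_le hxz
    have hd2 : orderOf z ∣ p * q := hG ▸ orderOf_dvd_natCard z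
    obtain ⟨k, hk⟩ := hd
    rw [hk, mul_comm p q] at hd2
    rcases (Nat.dvd_prime hp).mp (Nat.dvd_of_mul_dvd_mul_left hq.pos hd2) with h | h
    · exfalso
      apply hz
      have : Subgroup.zpowers x = Subgroup.zpowers z := by
        apply Subgroup.eq_of_le_of_card_ge hxz
        rw [hcard, Nat.card_zpowers, hk, h, mul_one]
      rw [this]; exact Subgroup.mem_zpowers z
    · exact isCyclic_of_orderOf_eq_card z (by rw [hk, h, hG, mul_comm])
  -- invariant Sylow
  obtain ⟨r, hr, hrd⟩ := Nat.exists_prime_and_dvd (Finite.one_lt_card (α := A)).ne'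
  have : Fact r.Prime := ⟨hr⟩
  obtain ⟨R, hR⟩ := aux_invSylow hf r x hx1 hN
  have hRm : ∀ (g : G) (a : A), a ∈ R → g • a ∈ R := by
    intro g a ha
    have := Subgroup.smul_mem_pointwise_smul a g (R : Subgroup A) ha
    rw [← Sylow.pointwise_smul_def, hR g] at this
    exact this
  have hRnt : Nontrivial R := by
    rw [← Finite.one_lt_card_iff_nontrivial]
    have h0 := R.dvd_card_of_dvd_card hrd
    have : Nat.card R ≠ 1 := fun h => hr.one_lt.ne' (Nat.dvd_one.mp (h ▸ h0))
    have := Nat.card_pos (α := R)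
    omega
  have hZ := R.isPGroup'.center_nontrivial
  clear hR
  obtain ⟨R, hRp, hRsyl⟩ := R
  change ∀ (g : G) (a : A), a ∈ R → g • a ∈ R at hRm
  change Nontrivial R at hRnt
  change Nontrivial (Subgroup.center R) at hZ
  letI : MulDistribMulAction G R :=
    { smul := fun g a => ⟨g • (a : A), hRm g a a.2⟩
      one_smul := fun a => Subtype.ext (one_smul G (a : A))
      mul_smul := fun g h a => Subtype.ext (mul_smul g h (a : A))
      smul_mul := fun g a b => Subtype.ext (smul_mul' g (a : A) (b : A))
      smul_one := fun g => Subtype.ext (smul_one g) }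
  have hfR : ∀ h : G, h ≠ 1 → ∀ a : R, h • a = a → a = 1 := fun h h1 a ha =>
    Subtype.ext (hf h h1 a (congrArg Subtype.val ha))
  have hCm : ∀ (g : G) (a : R), a ∈ Subgroup.center R → g • a ∈ Subgroup.center R := by
    intro g a ha
    rw [Subgroup.mem_center_iff] at *
    intro b
    have := congrArg (g • ·) (ha (g⁻¹ • b))
    simpa [smul_mul'] using this
  let instC : CommGroup (Subgroup.center R) :=
    { (inferInstance : Group (Subgroup.center R)) with
      mul_comm := fun a b => Subtype.ext ((Subgroup.mem_center_iff.mp b.2 a)) }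
  let instM : MulDistribMulAction G (Subgroup.center R) :=
    { smul := fun g a => ⟨g • (a : R), hCm g a a.2⟩
      one_smul := fun a => Subtype.ext (one_smul G (a : R))
      mul_smul := fun g h a => Subtype.ext (mul_smul g h (a : R))
      smul_mul := fun g a b => Subtype.ext (smul_mul' g (a : R) (b : R))
      smul_one := fun g => Subtype.ext (smul_one g) }
  have hfZ : ∀ h : G, h ≠ 1 → ∀ a : Subgroup.center R, h • a = a → a = 1 := fun h h1 a ha =>
    Subtype.ext (hfR h h1 a (congrArg Subtype.val ha))
  obtain ⟨v, hv⟩ := exists_ne (1 : Subgroup.center R)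
  have hvq : v ^ q = 1 := by
    have := aux_key hfZ p hp (Subgroup.zpowers x)
      (by rwa [Ne, Subgroup.zpowers_eq_bot]) y hyN hyp v
    rwa [hcard] at this
  -- contradiction: q ∣ card, but the group of order q acts freely on the nonidentity elements
  have hqd : q ∣ Nat.card (Subgroup.center R) := by
    rw [← orderOf_eq_prime hvq hv]
    exact orderOf_dvd_natCard v
  have hpg : IsPGroup q (Subgroup.zpowers x) := IsPGroup.of_card (n := 1) (by rw [hcard, pow_one])
  obtain ⟨w, hw, hw1⟩ := hpg.exists_fixed_point_of_prime_dvd_card_of_fixed_point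
    (Subgroup.center R) hqd (a := 1) (fun g => smul_one (g : G))
  exact hw1 (hfZ x hx1 w (hw ⟨x, Subgroup.mem_zpowers x⟩)).symm

theorem stmt_9 {A B : Type*} [Group A] [Group B] [Finite A] [Finite B] [Nontrivial A]
    (φ : B →* MulAut A)
    (hfree : ∀ b : B, b ≠ 1 → ∀ a : A, φ b a = a → a = 1)
    (p q : ℕ) (hp : p.Prime) (hq : q.Prime)
    (H : Subgroup B) (hH : Nat.card H = p * q) :
    IsCyclic H := by
  letI : MulDistribMulAction H A := MulDistribMulAction.compHom A (φ.comp H.subtype)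
  have hf : ∀ h : H, h ≠ 1 → ∀ a : A, h • a = a → a = 1 := fun h h1 a ha =>
    hfree h (fun h2 => h1 (Subtype.ext h2)) a ha
  rcases le_total p q with h | h
  · exact aux_main hf p q hp hq h hH
  · exact aux_main hf q p hq hp h (by rw [hH, mul_comm])
end

section
/- Let G be a finite group in which every conjugacy class has size 1, p^a, q^b, or p^a·q^b for fixed primes p ≠ q and fixed positive integers a, b, and suppose each of these four sizes occurs as the size of some conjugacy class. Then G is nilpotent. -/
/-- `csize x` is the size of the conjugacy class of `x`. -/
noncomputable def csize {G : Type*} [Group G] (x : G) : ℕ :=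
  Nat.card {y : G // IsConj x y}

set_option linter.unusedSectionVars false
namespace CamThm

open Subgroup

/-- centralizer of an element -/
abbrev Cz {G : Type*} [Group G] (x : G) : Subgroup G := Subgroup.centralizer {x}

/-- element of `p`-power order -/
def PEl {G : Type*} [Group G] (p : ℕ) (x : G) : Prop := ∃ k : ℕ, x ^ p ^ k = 1

section generic

variable {G : Type*} [Group G]

lemma mem_Cz {x g : G} : g ∈ Cz x ↔ g * x = x * g := by
  rw [Subgroup.mem_centralizer_singleton_iff]

lemma mem_Cz_comm {x g : G} : g ∈ Cz x ↔ x ∈ Cz g := by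
  rw [mem_Cz, mem_Cz]; exact eq_comm

lemma csize_eq (x : G) : csize x = (Cz x).index := by
  have h1 : csize x = Nat.card (MulAction.orbit (ConjAct G) x) := by
    unfold csize
    refine Nat.card_congr (Equiv.subtypeEquivRight fun y => ?_)
    rw [ConjAct.mem_orbit_conjAct]
    exact isConj_comm
  rw [h1, Nat.card_coe_set_eq, ← MulAction.index_stabilizer, ConjAct.stabilizer_eq_centralizer]
  rfl

lemma covering [Finite G] (H : Subgroup G) (h : ∀ g : G, ∃ k : G, k * g * k⁻¹ ∈ H) : H = ⊤ := by
  let f : (G ⧸ H) × H → G := fun c => c.1.out * c.2 * c.1.out⁻¹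
  have hf : Function.Surjective f := by
    intro g
    obtain ⟨k, hk⟩ := h g
    obtain ⟨m, hm⟩ := QuotientGroup.mk_out_eq_mul H k⁻¹
    refine ⟨((k⁻¹ : G), ⟨(m : G)⁻¹ * (k * g * k⁻¹) * m, H.mul_mem (H.mul_mem (H.inv_mem m.2) hk) m.2⟩), ?_⟩
    simp only [f]
    rw [hm]
    group
  have hc : Nat.card ((G ⧸ H) × H) = Nat.card G := by
    rw [Nat.card_prod, H.card_eq_card_quotient_mul_card_subgroup]
  have hb : Function.Bijective f := (Nat.bijective_iff_surjective_and_card f).2 ⟨hf, hc⟩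
  rw [← Subgroup.index_eq_one, Subgroup.index_eq_card, Nat.card_eq_one_iff_unique]
  refine ⟨⟨fun a b => ?_⟩, ⟨(1 : G)⟩⟩
  have := @hb.1 (a, 1) (b, 1) (by simp [f])
  exact (Prod.mk.inj this).1

lemma mem_of_pow_mem_coprime (H : Subgroup G) {g : G} {n : ℕ} (hn : (orderOf g).Coprime n)
    (h : g ^ n ∈ H) : g ∈ H := by
  obtain ⟨m, hm⟩ := exists_pow_eq_self_of_coprime hn.symm
  rw [← hm]; exact H.pow_mem h m

lemma PEl.orderOf {p : ℕ} (hp : p.Prime) {x : G} (h : PEl p x) : ∃ k, orderOf x = p ^ k := by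
  obtain ⟨k, hk⟩ := h
  obtain ⟨m, _, hm⟩ := (Nat.dvd_prime_pow hp).1 (orderOf_dvd_of_pow_eq_one hk)
  exact ⟨m, hm⟩

lemma PEl.coprime {p n : ℕ} (hp : p.Prime) {x : G} (h : PEl p x) (hn : n.Coprime p) :
    (_root_.orderOf x).Coprime n := by
  obtain ⟨k, hk⟩ := h.orderOf hp
  rw [hk]; exact (Nat.Coprime.pow_right k hn).symm

lemma PEl.conj {p : ℕ} {x : G} (h : PEl p x) (g : G) : PEl p (g * x * g⁻¹) := by
  obtain ⟨k, hk⟩ := h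
  exact ⟨k, by rw [conj_pow, hk]; simp⟩

lemma PEl.inv {p : ℕ} {x : G} (h : PEl p x) : PEl p x⁻¹ := by
  obtain ⟨k, hk⟩ := h
  exact ⟨k, by rw [inv_pow, hk]; simp⟩

lemma PEl.pow {p : ℕ} {x : G} (h : PEl p x) (n : ℕ) : PEl p (x ^ n) := by
  obtain ⟨k, hk⟩ := h
  exact ⟨k, by rw [← pow_mul, mul_comm, pow_mul, hk, one_pow]⟩

lemma PEl.mul {p : ℕ} {x y : G} (hx : PEl p x) (hy : PEl p y) (h : Commute x y) :
    PEl p (x * y) := by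
  obtain ⟨k, hk⟩ := hx
  obtain ⟨m, hm⟩ := hy
  exact ⟨k + m, by rw [h.mul_pow, pow_add, pow_mul, hk, mul_comm, pow_mul, hm]; simp⟩

lemma PEl.of_pgroup {p : ℕ} {S : Subgroup G} (h : IsPGroup p S) {x : G} (hx : x ∈ S) : PEl p x := by
  obtain ⟨k, hk⟩ := h ⟨x, hx⟩
  exact ⟨k, by simpa [Subtype.ext_iff] using hk⟩

lemma PEl.zpowers {p : ℕ} {x : G} (h : PEl p x) : IsPGroup p (Subgroup.zpowers x) := by
  rintro ⟨y, hy⟩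
  obtain ⟨n, rfl⟩ := Subgroup.mem_zpowers_iff.1 hy
  obtain ⟨k, hk⟩ := h
  refine ⟨k, ?_⟩
  ext
  simp only [SubmonoidClass.coe_pow, OneMemClass.coe_one]
  rw [← zpow_natCast, ← zpow_mul, mul_comm, zpow_mul, zpow_natCast, hk, one_zpow]

lemma eq_one_of_PEl_two {p q : ℕ} (hp : p.Prime) (hq : q.Prime) (hpq : p ≠ q) {x : G}
    (h1 : PEl p x) (h2 : PEl q x) : x = 1 := by
  obtain ⟨k, hk⟩ := h2.orderOf hq
  have := h1.coprime hp (n := q ^ k) (Nat.Coprime.pow_left k ((Nat.coprime_primes hq hp).2 hpq.symm))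
  rw [hk, Nat.coprime_self] at this
  rw [← orderOf_eq_one_iff, hk, this]

/-- commuting coprime: the factors are powers of the product -/
lemma mem_zpowers_mul {x y : G} (hc : Commute x y) (h : (orderOf x).Coprime (orderOf y)) :
    x ∈ Subgroup.zpowers (x * y) := by
  have h1 : (x * y) ^ orderOf y = x ^ orderOf y := by rw [hc.mul_pow, pow_orderOf_eq_one, mul_one]
  refine mem_of_pow_mem_coprime _ h ?_
  rw [← h1]
  exact Subgroup.pow_mem _ (Subgroup.mem_zpowers _) _

lemma Cz_le_of_mem_zpowers {x y : G} (h : x ∈ Subgroup.zpowers y) : Cz y ≤ Cz x := by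
  intro g hg
  obtain ⟨n, rfl⟩ := Subgroup.mem_zpowers_iff.1 h
  rw [mem_Cz] at *
  exact (show Commute g y from hg).zpow_right n

lemma Cz_mul {x y : G} (hc : Commute x y) (h : (orderOf x).Coprime (orderOf y)) :
    Cz (x * y) = Cz x ⊓ Cz y := by
  apply le_antisymm
  · refine le_inf (Cz_le_of_mem_zpowers (mem_zpowers_mul hc h)) (Cz_le_of_mem_zpowers ?_)
    rw [hc.eq]
    exact mem_zpowers_mul hc.symm h.symm
  · rintro g ⟨h1, h2⟩
    have h1 := mem_Cz.1 h1
    have h2 := mem_Cz.1 h2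
    rw [mem_Cz]
    exact (show Commute g x from h1).mul_right h2

/-- `p`-part decomposition -/
lemma decomp [Finite G] {p : ℕ} (hp : p.Prime) (g : G) : ∃ u v : G, u ∈ Subgroup.zpowers g ∧
    v ∈ Subgroup.zpowers g ∧ PEl p u ∧ (orderOf v).Coprime p ∧ g = u * v := by
  have hn : orderOf g ≠ 0 := (orderOf_pos g).ne'
  set k := (orderOf g).factorization p
  set m := orderOf g / p ^ k
  have hkm : p ^ k * m = orderOf g := Nat.ordProj_mul_ordCompl_eq_self _ _
  have hcop : Nat.Coprime p m := Nat.coprime_ordCompl hp hn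
  have hcop' : Nat.Coprime (p ^ k) m := Nat.Coprime.pow_left k hcop
  have hbez := Nat.gcd_eq_gcd_ab (p ^ k) m
  rw [hcop'.gcd_eq_one] at hbez
  set A := Nat.gcdA (p ^ k) m
  set B := Nat.gcdB (p ^ k) m
  refine ⟨g ^ ((m : ℤ) * B), g ^ (((p ^ k : ℕ) : ℤ) * A), Subgroup.zpow_mem _ (Subgroup.mem_zpowers g) _,
    Subgroup.zpow_mem _ (Subgroup.mem_zpowers g) _, ⟨k, ?_⟩, ?_, ?_⟩
  · rw [← zpow_natCast, ← zpow_mul]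
    have : (m : ℤ) * B * ((p ^ k : ℕ) : ℤ) = (orderOf g : ℤ) * B := by
      rw [← hkm]; push_cast; ring
    rw [this, zpow_mul, zpow_natCast, pow_orderOf_eq_one, one_zpow]
  · have h : orderOf (g ^ (((p ^ k : ℕ) : ℤ) * A)) ∣ m := by
      apply orderOf_dvd_of_pow_eq_one
      rw [← zpow_natCast, ← zpow_mul]
      have : ((p ^ k : ℕ) : ℤ) * A * (m : ℤ) = (orderOf g : ℤ) * A := by
        rw [← hkm]; push_cast; ring
      rw [this, zpow_mul, zpow_natCast, pow_orderOf_eq_one, one_zpow]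
    exact Nat.Coprime.coprime_dvd_left h hcop.symm
  · rw [← zpow_add, add_comm, ← hbez]; simp

/-- internal Sylow subgroups -/
def IsSyl (p : ℕ) (S H : Subgroup G) : Prop :=
  S ≤ H ∧ Nat.card S = p ^ (Nat.card H).factorization p

lemma IsSyl.pgroup {p : ℕ} {S H : Subgroup G} (h : IsSyl p S H) : IsPGroup p S := IsPGroup.of_card h.2

variable [Finite G]

lemma exists_syl {p : ℕ} (hp : p.Prime) (H : Subgroup G) : ∃ S, IsSyl p S H := by
  have := Fact.mk hp
  obtain ⟨P⟩ : Nonempty (Sylow p H) := inferInstance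
  refine ⟨(P : Subgroup H).map H.subtype, Subgroup.map_subtype_le _, ?_⟩
  rw [Subgroup.card_map_of_injective H.subtype_injective]
  exact P.card_eq_multiplicity

/-- a `p`-subgroup of `H` can be conjugated into a Sylow of `H` -/
lemma IsSyl.conj_le {p : ℕ} (hp : p.Prime) {S H T : Subgroup G} (hS : IsSyl p S H) (hT : T ≤ H)
    (hTp : IsPGroup p T) : ∃ h ∈ H, ∀ t ∈ T, h * t * h⁻¹ ∈ S := by
  have := Fact.mk hp
  have hcard : Nat.card (S.subgroupOf H) = p ^ (Nat.card H).factorization p := by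
    rw [← hS.2]; exact Nat.card_congr (Subgroup.subgroupOfEquivOfLe hS.1).toEquiv
  let P : Sylow p H := Sylow.ofCard (S.subgroupOf H) hcard
  have hT' : IsPGroup p (T.subgroupOf H) :=
    hTp.of_injective (Subgroup.subgroupOfEquivOfLe hT).toMonoidHom
      (Subgroup.subgroupOfEquivOfLe hT).injective
  obtain ⟨Q, hQ⟩ := hT'.exists_le_sylow
  obtain ⟨h, hh⟩ := MulAction.exists_smul_eq H Q P
  refine ⟨h, h.2, fun t ht => ?_⟩
  have h1 : (⟨t, hT ht⟩ : H) ∈ Q := hQ (by simpa [Subgroup.mem_subgroupOf] using ht)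
  have h2 : h * ⟨t, hT ht⟩ * h⁻¹ ∈ (P : Subgroup H) := by
    rw [← hh, Sylow.coe_subgroup_smul]
    have := Subgroup.smul_mem_pointwise_smul _ (MulAut.conj h) _ h1
    simpa using this
  have h3 : h * ⟨t, hT ht⟩ * h⁻¹ ∈ S.subgroupOf H := h2
  simpa [Subgroup.mem_subgroupOf] using h3

lemma PEl.card_dvd {p : ℕ} (hp : p.Prime) {S H : Subgroup G} (hS : IsPGroup p S) (h : S ≤ H) :
    Nat.card S ∣ p ^ (Nat.card H).factorization p := by
  have := Fact.mk hp
  obtain ⟨k, hk⟩ := IsPGroup.iff_card.1 hS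
  have := Subgroup.card_dvd_of_le h
  rw [hk] at this ⊢
  exact pow_dvd_pow _ ((hp.pow_dvd_iff_le_factorization Nat.card_pos.ne').1 this)

end generic
end CamThm
set_option linter.unusedSectionVars false
namespace CamThm
open Subgroup
section generic2
variable {G : Type*} [Group G] [Finite G]

lemma csize_sub (H : Subgroup G) (k : H) : csize k = (Cz (k : G)).relIndex H := by
  rw [csize_eq, Subgroup.relIndex]
  congr 1
  ext g
  rw [mem_Cz, Subgroup.mem_subgroupOf, mem_Cz]
  simp [Subtype.ext_iff]

lemma csize_ne_zero (g : G) : csize g ≠ 0 := by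
  rw [csize_eq]; exact Subgroup.index_ne_zero_of_finite

lemma fac (p : ℕ) (g : G) : (Nat.card (Cz g)).factorization p + (csize g).factorization p =
    (Nat.card G).factorization p := by
  rw [csize_eq, ← (Cz g).card_mul_index, Nat.factorization_mul Nat.card_pos.ne'
    Subgroup.index_ne_zero_of_finite]
  rfl

lemma csize_dvd {g h : G} (hle : Cz g ≤ Cz h) : csize h ∣ csize g := by
  rw [csize_eq, csize_eq]; exact Subgroup.index_dvd_of_le hle

lemma Cz_eq_of_le {g h : G} (hle : Cz g ≤ Cz h) (hc : csize g = csize h) : Cz g = Cz h := by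
  rw [csize_eq, csize_eq] at hc
  by_contra hne
  have := Subgroup.index_strictAnti (lt_of_le_of_ne hle hne)
  omega

lemma Cz_conj (g x : G) : Cz (g * x * g⁻¹) = (Cz x).map (MulAut.conj g).toMonoidHom := by
  ext y
  simp only [Subgroup.mem_map, mem_Cz]
  constructor
  · intro h
    refine ⟨g⁻¹ * y * g, ?_, by simp [mul_assoc]⟩
    have h2 : y * (g * x * g⁻¹) * g = (g * x * g⁻¹) * y * g := by rw [h]
    calc g⁻¹ * y * g * x = g⁻¹ * (y * (g * x * g⁻¹) * g) := by group
      _ = g⁻¹ * ((g * x * g⁻¹) * y * g) := by rw [h2]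
      _ = x * (g⁻¹ * y * g) := by group
  · rintro ⟨z, hz, rfl⟩
    simp only [MulEquiv.toMonoidHom_eq_coe, MonoidHom.coe_coe, MulAut.conj_apply]
    calc g * z * g⁻¹ * (g * x * g⁻¹) = g * (z * x) * g⁻¹ := by group
      _ = g * (x * z) * g⁻¹ := by rw [hz]
      _ = _ := by group

lemma csize_conj (g x : G) : csize (g * x * g⁻¹) = csize x := by
  unfold csize
  refine Nat.card_congr (Equiv.subtypeEquivRight fun y => ?_)
  have : IsConj x (g * x * g⁻¹) := isConj_iff.2 ⟨g, rfl⟩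
  exact ⟨fun h => this.trans h, fun h => this.symm.trans h⟩

lemma csize_eq_one_iff (x : G) : csize x = 1 ↔ x ∈ center G := by
  rw [csize_eq, Subgroup.index_eq_one, Subgroup.mem_center_iff]
  constructor
  · intro h g
    have : g ∈ Cz x := h ▸ Subgroup.mem_top g
    exact mem_Cz.1 this
  · intro h
    rw [eq_top_iff]
    intro g _
    exact mem_Cz.2 (h g)

lemma syl_top_of_not_dvd {p : ℕ} {g : G} (h : ¬ p ∣ csize g) {S : Subgroup G}
    (hS : IsSyl p S (Cz g)) : IsSyl p S ⊤ := by
  refine ⟨le_top, ?_⟩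
  have := fac p g
  rw [Nat.factorization_eq_zero_of_not_dvd h, add_zero] at this
  rw [hS.2, this, Subgroup.card_top]

lemma exists_conj_Cz {p : ℕ} (hp : p.Prime) {g : G} (h : ¬ p ∣ csize g) {T : Subgroup G}
    (hT : IsPGroup p T) : ∃ k : G, ∀ t ∈ T, t ∈ Cz (k * g * k⁻¹) := by
  obtain ⟨S, hS⟩ := exists_syl hp (Cz g)
  obtain ⟨k, _, hk⟩ := (syl_top_of_not_dvd h hS).conj_le hp (le_top : T ≤ ⊤) hT
  refine ⟨k⁻¹, fun t ht => ?_⟩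
  have h1 := mem_Cz.1 (hS.1 (hk t ht))
  rw [mem_Cz]
  calc t * (k⁻¹ * g * k⁻¹⁻¹) = k⁻¹ * (k * t * k⁻¹ * g) * k := by group
    _ = k⁻¹ * (g * (k * t * k⁻¹)) * k := by rw [h1]
    _ = _ := by group

/-- a prime not dividing any class size has central Sylow -/
lemma central_of_not_dvd {r : ℕ} (hr : r.Prime) (h : ∀ g : G, ¬ r ∣ csize g) (R : Subgroup G)
    (hR : IsPGroup r R) : R ≤ center G := by
  have key : Subgroup.centralizer (R : Set G) = ⊤ := by
    apply covering
    intro g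
    obtain ⟨k, hk⟩ := exists_conj_Cz hr (h g) hR
    refine ⟨k, ?_⟩
    rw [Subgroup.mem_centralizer_iff]
    intro t ht
    exact mem_Cz.1 (hk t ht)
  intro x hx
  rw [Subgroup.mem_center_iff]
  intro g
  have : g ∈ Subgroup.centralizer (R : Set G) := key ▸ Subgroup.mem_top g
  exact (Subgroup.mem_centralizer_iff.1 this x hx).symm

lemma IsSyl.mem_of_normal {p : ℕ} (hp : p.Prime) {S H : Subgroup G} (hS : IsSyl p S H)
    {N : Subgroup G} (hN : N.Normal) (hNp : IsPGroup p N) (hle : N ≤ H) : N ≤ S := by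
  obtain ⟨h, _, hh⟩ := hS.conj_le hp hle hNp
  intro x hx
  have := hh (h⁻¹ * x * h) (by simpa using hN.conj_mem x hx h⁻¹)
  simpa [mul_assoc] using this

/-- Lemma A -/
lemma lemA {p : ℕ} (hp : p.Prime) (h : ∀ g : G, (orderOf g).Coprime p → ¬ p ∣ csize g)
    (P : Subgroup G) (hP : IsSyl p P ⊤) :
    P.Normal ∧ ∀ u g : G, PEl p u → (orderOf g).Coprime p → Commute u g := by
  have key : P ⊔ Subgroup.centralizer (P : Set G) = ⊤ := by
    apply covering
    intro g
    obtain ⟨u, v, hu, hv, hup, hvp, rfl⟩ := decomp hp g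
    obtain ⟨S, hS⟩ := exists_syl hp (Cz v)
    have hSt := syl_top_of_not_dvd (h v hvp) hS
    have huv : Commute u v := by
      obtain ⟨n, hn⟩ := Subgroup.mem_zpowers_iff.1 hu
      obtain ⟨m, hm⟩ := Subgroup.mem_zpowers_iff.1 hv
      have := Commute.zpow_zpow_self (u * v) n m
      rwa [hn, hm] at this
    obtain ⟨k, hk, hkS⟩ := hS.conj_le hp (T := Subgroup.zpowers u)
      (by rw [Subgroup.zpowers_le, mem_Cz]; exact huv) hup.zpowers
    obtain ⟨l, _, hl⟩ := hP.conj_le hp (T := S) le_top hS.pgroup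
    have hSP : ∀ t ∈ P, l⁻¹ * t * l ∈ S := by
      have hmap : S.map (MulAut.conj l).toMonoidHom = P := by
        apply Subgroup.eq_of_le_of_card_ge
        · rintro _ ⟨s, hs, rfl⟩
          simpa using hl s hs
        · rw [Subgroup.card_map_of_injective (MulAut.conj l).injective, hSt.2, hP.2]
      intro t ht
      rw [← hmap] at ht
      obtain ⟨s, hs, rfl⟩ := ht
      simpa [mul_assoc] using hs
    refine ⟨l * k, ?_⟩
    have e : l * k * (u * v) * (l * k)⁻¹ = (l * (k * u * k⁻¹) * l⁻¹) * (l * v * l⁻¹) := by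
      have := mem_Cz.1 hk
      calc l * k * (u * v) * (l * k)⁻¹ = l * (k * u * k⁻¹) * (k * v) * k⁻¹ * l⁻¹ := by group
        _ = l * (k * u * k⁻¹) * (v * k) * k⁻¹ * l⁻¹ := by rw [this]
        _ = _ := by group
    rw [e]
    refine Subgroup.mul_mem_sup (hl _ (hkS u (Subgroup.mem_zpowers u))) ?_
    rw [Subgroup.mem_centralizer_iff]
    intro t ht
    have := mem_Cz.1 (hS.1 (hSP t ht))
    calc t * (l * v * l⁻¹) = l * (l⁻¹ * t * l * v) * l⁻¹ := by group
      _ = l * (v * (l⁻¹ * t * l)) * l⁻¹ := by rw [this]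
      _ = _ := by group
  have hPn : P.Normal := by
    rw [← Subgroup.normalizer_eq_top_iff, eq_top_iff, ← key]
    exact sup_le Subgroup.le_normalizer (Subgroup.centralizer_le_normalizer _)
  refine ⟨hPn, fun u g hu hg => ?_⟩
  have huP : u ∈ P := by
    obtain ⟨k, _, hk⟩ := hP.conj_le hp (T := Subgroup.zpowers u) le_top hu.zpowers
    have h1 := hPn.conj_mem _ (hk u (Subgroup.mem_zpowers u)) k⁻¹
    simpa [mul_assoc] using h1
  have hgC : g ∈ Subgroup.centralizer (P : Set G) := by
    refine mem_of_pow_mem_coprime _ (n := Nat.card P) ?_ ?_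
    · rw [hP.2]; exact Nat.Coprime.pow_right _ hg
    · have hg' : g ∈ P ⊔ Subgroup.centralizer (P : Set G) := key ▸ Subgroup.mem_top g
      obtain ⟨y, hy, z, hz, rfl⟩ := Subgroup.mem_sup_of_normal_left.1 hg'
      have hyz : Commute y z := Subgroup.mem_centralizer_iff.1 hz y hy
      rw [hyz.mul_pow]
      have : y ^ Nat.card P = 1 := by
        have := pow_card_eq_one' (x := (⟨y, hy⟩ : P))
        exact congrArg Subtype.val this
      rw [this, one_mul]
      exact Subgroup.pow_mem _ hz _
  exact Subgroup.mem_centralizer_iff.1 hgC u huP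

/-- coprime indices -/
lemma coprime_factor {H K : Subgroup G} (h : H.index.Coprime K.index) (g : G) :
    ∃ c ∈ H, ∃ d ∈ K, g = c * d := by
  have h1 : (H ⊓ K).index = K.relIndex H * H.index := by
    rw [← Subgroup.inf_relIndex_left, Subgroup.relIndex_mul_index inf_le_left]
  have h2 : K.index ∣ K.relIndex H :=
    h.symm.dvd_of_dvd_mul_right (h1 ▸ Subgroup.index_dvd_of_le inf_le_right)
  have hpos : K.relIndex H ≠ 0 := Subgroup.index_ne_zero_of_finite
  have h3 : K.index ≤ K.relIndex H := Nat.le_of_dvd (Nat.pos_of_ne_zero hpos) h2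
  let f : (H ⧸ K.subgroupOf H) → G ⧸ K := Quotient.map' (fun x : H => (x : G)) (by
    intro a b hab
    rw [QuotientGroup.leftRel_apply] at *
    simpa [Subgroup.mem_subgroupOf] using hab)
  have hinj : Function.Injective f := by
    intro a b
    induction a using QuotientGroup.induction_on with | _ a => ?_
    induction b using QuotientGroup.induction_on with | _ b => ?_
    intro hab
    have hab' : ((a : G) : G ⧸ K) = ((b : G) : G ⧸ K) := hab
    rw [QuotientGroup.eq] at hab' ⊢
    simpa [Subgroup.mem_subgroupOf] using hab'
  have hsurj : Function.Surjective f := by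
    have hb : Function.Bijective f := by
      refine (Nat.bijective_iff_injective_and_card f).2 ⟨hinj, ?_⟩
      refine le_antisymm (Nat.card_le_card_of_injective f hinj) h3
    exact hb.2
  obtain ⟨a, ha⟩ := hsurj (g : G ⧸ K)
  induction a using QuotientGroup.induction_on with | _ a => ?_
  have ha' : ((a : G) : G ⧸ K) = (g : G ⧸ K) := ha
  rw [QuotientGroup.eq] at ha'
  exact ⟨a, a.2, (a : G)⁻¹ * g, ha', by group⟩

/-- the `q`-torsion of an abelian normal subgroup -/
lemma torsion_normal {q : ℕ} (A : Subgroup G) (hA : A.Normal)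
    (hc : ∀ x ∈ A, ∀ y ∈ A, x * y = y * x) :
    ∃ Y : Subgroup G, Y.Normal ∧ Y ≤ A ∧ IsPGroup q Y ∧ ∀ x ∈ A, PEl q x → x ∈ Y := by
  refine ⟨{ carrier := {x | x ∈ A ∧ PEl q x}
            mul_mem' := ?_, one_mem' := ?_, inv_mem' := ?_ }, ⟨?_⟩, ?_, ?_, ?_⟩
  · rintro x y ⟨hx, hx'⟩ ⟨hy, hy'⟩
    exact ⟨A.mul_mem hx hy, hx'.mul hy' (hc x hx y hy)⟩
  · exact ⟨A.one_mem, 0, by simp⟩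
  · rintro x ⟨hx, hx'⟩
    exact ⟨A.inv_mem hx, hx'.inv⟩
  · rintro x ⟨hx, hx'⟩ g
    exact ⟨hA.conj_mem x hx g, hx'.conj g⟩
  · rintro x ⟨hx, _⟩; exact hx
  · rintro ⟨x, hx, k, hk⟩
    exact ⟨k, by ext; simpa using hk⟩
  · intro x hx hx'; exact ⟨hx, hx'⟩

end generic2
end CamThm
set_option linter.unusedSectionVars false
namespace CamThm
open Subgroup

/-- the standing hypothesis -/
structure Hyp (G : Type*) [Group G] (p q a b : ℕ) : Prop where
  hp : p.Prime
  hq : q.Prime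
  hpq : p ≠ q
  ha : 0 < a
  hb : 0 < b
  hs : ∀ x : G, csize x = 1 ∨ csize x = p ^ a ∨ csize x = q ^ b ∨ csize x = p ^ a * q ^ b

namespace Hyp
variable {G : Type*} [Group G] [Finite G] {p q a b : ℕ}

lemma symm (H : Hyp G p q a b) : Hyp G q p b a :=
  ⟨H.hq, H.hp, H.hpq.symm, H.hb, H.ha, fun x => by
    rcases H.hs x with h | h | h | h
    · exact Or.inl h
    · exact Or.inr (Or.inr (Or.inl h))
    · exact Or.inr (Or.inl h)
    · exact Or.inr (Or.inr (Or.inr (by rw [h, mul_comm])))⟩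

lemma cop (H : Hyp G p q a b) : Nat.Coprime p q := (Nat.coprime_primes H.hp H.hq).2 H.hpq

lemma dvd_full (H : Hyp G p q a b) (g : G) : csize g ∣ p ^ a * q ^ b := by
  rcases H.hs g with h | h | h | h <;> rw [h]
  · exact one_dvd _
  · exact dvd_mul_right _ _
  · exact dvd_mul_left _ _

lemma not_p_dvd_q (H : Hyp G p q a b) : ¬ p ∣ q ^ b := fun h =>
  H.hpq ((Nat.prime_dvd_prime_iff_eq H.hp H.hq).1 (H.hp.dvd_of_dvd_pow h))

lemma cases_p (H : Hyp G p q a b) {g : G} (h : p ∣ csize g) :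
    csize g = p ^ a ∨ csize g = p ^ a * q ^ b := by
  rcases H.hs g with h' | h' | h' | h'
  · rw [h'] at h; exact absurd (Nat.dvd_one.1 h) H.hp.ne_one
  · exact Or.inl h'
  · rw [h'] at h; exact absurd h H.not_p_dvd_q
  · exact Or.inr h'

lemma full (H : Hyp G p q a b) {g : G} (h : p ∣ csize g) (h2 : q ∣ csize g) :
    csize g = p ^ a * q ^ b := by
  rcases H.cases_p h with h' | h'
  · rw [h'] at h2; exact absurd h2 H.symm.not_p_dvd_q
  · exact h'

lemma central_of (H : Hyp G p q a b) {g : G} (h : ¬ p ∣ csize g) (h2 : ¬ q ∣ csize g) :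
    g ∈ center G := by
  rw [← csize_eq_one_iff]
  rcases H.hs g with h' | h' | h' | h'
  · exact h'
  · exact absurd (h' ▸ dvd_pow_self p H.ha.ne') h
  · exact absurd (h' ▸ dvd_pow_self q H.hb.ne') h2
  · exact absurd (h' ▸ Dvd.dvd.mul_right (dvd_pow_self p H.ha.ne') _) h

lemma eq_p (H : Hyp G p q a b) {g : G} (h : p ∣ csize g) (h2 : ¬ q ∣ csize g) :
    csize g = p ^ a := by
  rcases H.cases_p h with h' | h'
  · exact h'
  · exact absurd (h' ▸ Dvd.dvd.mul_left (dvd_pow_self q H.hb.ne') _) h2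

lemma fac_eq (H : Hyp G p q a b) {g : G} (h : p ∣ csize g) : (csize g).factorization p = a := by
  have hq0 : (q ^ b).factorization p = 0 := Nat.factorization_eq_zero_of_not_dvd H.not_p_dvd_q
  rcases H.cases_p h with h' | h' <;> rw [h']
  · simp [H.hp.factorization_pow]
  · rw [Nat.factorization_mul (pow_pos H.hp.pos _).ne' (pow_pos H.hq.pos _).ne']
    rw [Finsupp.add_apply, hq0]; simp [H.hp.factorization_pow]

lemma fac_le (H : Hyp G p q a b) (g : G) : (csize g).factorization p ≤ a := by
  by_cases h : p ∣ csize g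
  · exact (H.fac_eq h).le
  · rw [Nat.factorization_eq_zero_of_not_dvd h]; omega

/-- minimality of the p-part of a centralizer -/
lemma cz_le (H : Hyp G p q a b) {g : G} (h : p ∣ csize g) (k : G) :
    (Nat.card (Cz g)).factorization p ≤ (Nat.card (Cz k)).factorization p := by
  have h1 := fac p g
  have h2 := fac p k
  have h3 := H.fac_eq h
  have h4 := H.fac_le k
  omega

lemma cz_eq (H : Hyp G p q a b) {g k : G} (h : p ∣ csize g) (h' : p ∣ csize k) :
    (Nat.card (Cz g)).factorization p = (Nat.card (Cz k)).factorization p :=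
  le_antisymm (H.cz_le h k) (H.cz_le h' g)

/-- a Sylow of `Cz k` contained in `Cz g` with `p ∣ csize g` is Sylow there -/
lemma syl_trans (H : Hyp G p q a b) {g k : G} (h : p ∣ csize g) {S : Subgroup G}
    (hS : IsSyl p S (Cz k)) (hle : S ≤ Cz g) : IsSyl p S (Cz g) := by
  refine ⟨hle, ?_⟩
  have h1 := PEl.card_dvd H.hp hS.pgroup hle
  rw [hS.2] at h1 ⊢
  rw [Nat.pow_dvd_pow_iff_le_right H.hp.one_lt] at h1
  rw [le_antisymm h1 (H.cz_le h k)]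

lemma full_max (H : Hyp G p q a b) {g t : G} (h : p ∣ csize t) (h2 : q ∣ csize t)
    (hle : Cz g ≤ Cz t) : Cz g = Cz t := by
  refine Cz_eq_of_le hle (Nat.dvd_antisymm ?_ (csize_dvd hle))
  rw [H.full h h2]; exact H.dvd_full g

lemma central_coprime (H : Hyp G p q a b) {z : G} (h1 : (orderOf z).Coprime p)
    (h2 : (orderOf z).Coprime q) : z ∈ center G := by
  refine mem_of_pow_mem_coprime _ (n := (center G).index) ?_ (Subgroup.pow_index_mem _ z)
  refine Nat.Coprime.symm (Nat.coprime_of_dvd fun r hr hr1 hr2 => ?_)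
  have hrp : r ≠ p := by
    rintro rfl
    exact hr.ne_one (Nat.dvd_one.1 (h1 ▸ Nat.dvd_gcd hr2 dvd_rfl))
  have hrq : r ≠ q := by
    rintro rfl
    exact hr.ne_one (Nat.dvd_one.1 (h2 ▸ Nat.dvd_gcd hr2 dvd_rfl))
  have hnd : ∀ g : G, ¬ r ∣ csize g := by
    intro g hg
    rcases (Nat.Prime.dvd_mul hr).1 (hg.trans (H.dvd_full g)) with h | h
    · exact hrp ((Nat.prime_dvd_prime_iff_eq hr H.hp).1 (hr.dvd_of_dvd_pow h))
    · exact hrq ((Nat.prime_dvd_prime_iff_eq hr H.hq).1 (hr.dvd_of_dvd_pow h))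
  have := Fact.mk hr
  obtain ⟨R⟩ : Nonempty (Sylow r G) := inferInstance
  have hR := central_of_not_dvd hr hnd R R.isPGroup'
  exact R.not_dvd_index (hr1.trans (Subgroup.index_dvd_of_le hR))

lemma decomp_q (H : Hyp G p q a b) {g : G} (hg : (orderOf g).Coprime p) : ∃ v z : G,
    v ∈ zpowers g ∧ z ∈ zpowers g ∧ PEl q v ∧ z ∈ center G ∧ g = v * z := by
  obtain ⟨v, z, hv, hz, hvq, hzq, e⟩ := decomp H.hq g
  exact ⟨v, z, hv, hz, hvq, H.central_coprime
    (Nat.Coprime.coprime_dvd_left (orderOf_dvd_of_mem_zpowers hz) hg) hzq, e⟩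

lemma decomp3 (H : Hyp G p q a b) (g : G) : ∃ u v z : G,
    u ∈ zpowers g ∧ v ∈ zpowers g ∧ PEl p u ∧ PEl q v ∧ z ∈ center G ∧ g = u * (v * z) := by
  obtain ⟨u, v, hu, hv, hup, hvp, e⟩ := decomp H.hp g
  obtain ⟨v', z, hv', hz, hvq, hzc, e'⟩ := H.decomp_q hvp
  exact ⟨u, v', z, hu, (Subgroup.zpowers_le.2 hv) hv', hup, hvq, hzc, by rw [← e', ← e]⟩

end Hyp

section
variable {G : Type*} [Group G]
lemma Cz_mul_central {z : G} (hz : z ∈ center G) (g : G) : Cz (g * z) = Cz g := by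
  ext y
  rw [mem_Cz, mem_Cz]
  have := Subgroup.mem_center_iff.1 hz
  constructor
  · intro h
    have h2 : y * g * z = g * y * z := by
      rw [mul_assoc, h, mul_assoc, mul_assoc, this y]
    exact mul_right_cancel h2
  · intro h
    rw [← mul_assoc, h, mul_assoc, this y, mul_assoc]

lemma csize_mul_central {z : G} (hz : z ∈ center G) (g : G) : csize (g * z) = csize g := by
  rw [csize_eq, csize_eq, Cz_mul_central hz]

lemma csize_central_mul {z : G} (hz : z ∈ center G) (g : G) : csize (z * g) = csize g := by
  rw [← Subgroup.mem_center_iff.1 hz g, csize_mul_central hz]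
end
end CamThm
set_option linter.unusedSectionVars false
namespace CamThm
open Subgroup

section
variable {G : Type*} [Group G] [Finite G]

lemma not_dvd_of_syl {p : ℕ} (hp : p.Prime) {S : Subgroup G} (hS : IsSyl p S ⊤) {y : G}
    (h : S ≤ Cz y) : ¬ p ∣ csize y := by
  intro hd
  have h1 := PEl.card_dvd hp hS.pgroup h
  rw [hS.2, Subgroup.card_top, Nat.pow_dvd_pow_iff_le_right hp.one_lt] at h1
  have h2 := fac p y
  have h3 := hp.factorization_pos_of_dvd (csize_ne_zero y) hd
  omega

lemma IsSyl.index_coprime {p : ℕ} (hp : p.Prime) {S : Subgroup G} (hS : IsSyl p S ⊤) :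
    S.index.Coprime p := by
  have h1 := S.card_mul_index
  have h0 : S.index ≠ 0 := Subgroup.index_ne_zero_of_finite
  refine ((Nat.Prime.coprime_iff_not_dvd hp).2 fun hd => ?_).symm
  have h2 := congrArg (fun n => n.factorization p) h1
  rw [Nat.factorization_mul Nat.card_pos.ne' h0, Finsupp.add_apply, hS.2, Subgroup.card_top] at h2
  have h3 := hp.factorization_pos_of_dvd h0 hd
  simp [hp.factorization_pow] at h2
  omega

lemma commute_of_zpowers {g u v : G} (hu : u ∈ zpowers g) (hv : v ∈ zpowers g) : Commute u v := by
  obtain ⟨n, hn⟩ := Subgroup.mem_zpowers_iff.1 hu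
  obtain ⟨m, hm⟩ := Subgroup.mem_zpowers_iff.1 hv
  have := Commute.zpow_zpow_self g n m
  rwa [hn, hm] at this

lemma PEl.cop {p q : ℕ} (hp : p.Prime) (hq : q.Prime) (hpq : p ≠ q) {x : G} (h : PEl p x) :
    (_root_.orderOf x).Coprime q :=
  h.coprime hp ((Nat.coprime_primes hq hp).2 hpq.symm)

lemma PEl.cop2 {p q : ℕ} (hp : p.Prime) (hq : q.Prime) (hpq : p ≠ q) {x y : G} (h : PEl p x)
    (h' : PEl q y) : (_root_.orderOf x).Coprime (_root_.orderOf y) :=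
  h.coprime hp (h'.cop hq hp hpq.symm)

/-- a `p`-element with `p`-power class size lies in a normal `p`-subgroup -/
lemma normal_p {p a : ℕ} (hp : p.Prime) {x : G} (hx : PEl p x) (h : csize x = p ^ a) :
    IsPGroup p (normalClosure {x}) := by
  obtain ⟨P, hP⟩ := exists_syl hp (⊤ : Subgroup G)
  obtain ⟨k, _, hk⟩ := hP.conj_le hp (T := zpowers x) le_top hx.zpowers
  have hk := hk x (mem_zpowers x)
  refine hP.pgroup.to_le ?_
  rw [normalClosure, closure_le]
  intro y hy
  rw [Group.mem_conjugatesOfSet_iff] at hy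
  obtain ⟨x', hx', hy⟩ := hy
  rw [Set.mem_singleton_iff.1 hx'] at hy
  obtain ⟨g, rfl⟩ := isConj_iff.1 hy
  have hc : P.index.Coprime (Cz (k * x * k⁻¹)).index := by
    rw [← csize_eq, csize_conj, h]
    exact Nat.Coprime.pow_right _ (hP.index_coprime hp)
  obtain ⟨c, hcP, d, hd, e⟩ := coprime_factor hc (g * k⁻¹)
  have h1 : d * (k * x * k⁻¹) * d⁻¹ = k * x * k⁻¹ := by rw [mem_Cz.1 hd]; group
  have h2 : g * x * g⁻¹ = c * (k * x * k⁻¹) * c⁻¹ := by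
    calc g * x * g⁻¹ = (g * k⁻¹) * (k * x * k⁻¹) * (g * k⁻¹)⁻¹ := by group
      _ = c * (d * (k * x * k⁻¹) * d⁻¹) * c⁻¹ := by rw [e]; group
      _ = _ := by rw [h1]
  rw [h2]
  exact P.mul_mem (P.mul_mem hcP hk) (P.inv_mem hcP)

lemma mem_nc (x : G) : x ∈ normalClosure ({x} : Set G) := subset_normalClosure rfl

end

namespace Hyp
variable {G : Type*} [Group G] [Finite G] {p q a b : ℕ}

lemma I1 (H : Hyp G p q a b) {x : G} (hx : PEl p x) (h : p ∣ csize x) {u g : G}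
    (hu : u ∈ Cz x) (hg : g ∈ Cz x) (hup : PEl p u) (hgp : (orderOf g).Coprime p) :
    Commute u g := by
  obtain ⟨P, hP⟩ := exists_syl H.hp (⊤ : Subgroup (Cz x))
  have key := (lemA H.hp (G := Cz x) (fun k hk hd => by
    rw [← Subgroup.orderOf_coe] at hk
    rw [csize_sub] at hd
    have hm := Cz_mul (x := x) (y := (k : G)) (mem_Cz.1 k.2).symm (hx.coprime H.hp hk)
    have h1 : csize (x * k) = (Cz (k : G)).relIndex (Cz x) * csize x := by
      rw [csize_eq, csize_eq, hm, ← Subgroup.inf_relIndex_left,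
        Subgroup.relIndex_mul_index inf_le_left]
    have h0 : (Cz (k : G)).relIndex (Cz x) ≠ 0 := Subgroup.index_ne_zero_of_finite
    have h2 := H.fac_le (x * k)
    rw [h1, Nat.factorization_mul h0 (csize_ne_zero x), Finsupp.add_apply, H.fac_eq h] at h2
    have h3 := H.hp.factorization_pos_of_dvd h0 hd
    omega) P hP).2 ⟨u, hu⟩ ⟨g, hg⟩
  have h1 := key (by
    obtain ⟨k, hk⟩ := hup
    exact ⟨k, Subtype.ext hk⟩) (by rw [← Subgroup.orderOf_coe]; exact hgp)
  exact congrArg Subtype.val h1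

lemma I3 (H : Hyp G p q a b) {x : G} (hx : PEl p x) (h : p ∣ csize x) (h' : ¬ q ∣ csize x)
    {y : G} (hy : PEl p y) (hyp : ¬ p ∣ csize y) : y ∈ center G := by
  refine H.central_of hyp ?_
  obtain ⟨S, hS⟩ := exists_syl H.hp (Cz y)
  have hN := normal_p H.hp hx (H.eq_p h h')
  have hxS := (syl_top_of_not_dvd hyp hS).mem_of_normal H.hp normalClosure_normal hN le_top
    (mem_nc x)
  have hyx : y ∈ Cz x := mem_Cz_comm.1 (hS.1 hxS)
  obtain ⟨T, hT⟩ := exists_syl H.hq (Cz x)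
  refine not_dvd_of_syl H.hq (syl_top_of_not_dvd h' hT) fun t ht => ?_
  rw [mem_Cz]
  exact (H.I1 hx h hyx (hT.1 ht) hy
    ((PEl.of_pgroup hT.pgroup ht).cop H.hq H.hp H.hpq.symm)).eq.symm

lemma I4a (H : Hyp G p q a b) {x : G} (hx : PEl p x) (h : p ∣ csize x) (h' : ¬ q ∣ csize x)
    {v : G} (hv : PEl q v) (hvx : v ∈ Cz x) : normalClosure {x} ≤ Cz v := by
  have := Fact.mk H.hp
  have hN := normal_p H.hp hx (H.eq_p h h')
  have hNn : (normalClosure ({x} : Set G)).Normal := normalClosure_normal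
  by_contra hcon
  set N := normalClosure ({x} : Set G) with hNdef
  have hlt : (Cz v).subgroupOf N < ⊤ := by
    rw [lt_top_iff_ne_top, Ne, Subgroup.subgroupOf_eq_top]; exact hcon
  have hnil : Group.IsNilpotent N := hN.isNilpotent
  obtain ⟨g, hg, hgD⟩ := SetLike.exists_of_lt (Group.normalizerCondition_of_isNilpotent _ hlt)
  rw [Subgroup.mem_normalizer_iff] at hg
  have h1 := (hg ⟨x, mem_nc x⟩).1 (by
    rw [Subgroup.mem_subgroupOf]; exact mem_Cz_comm.1 hvx)
  rw [Subgroup.mem_subgroupOf] at h1 hgD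
  have h1 := mem_Cz.1 h1
  simp only [Subgroup.coe_mul, Subgroup.coe_inv] at h1
  obtain ⟨g, hgN⟩ := g
  simp only at h1 hgD
  have hc : g⁻¹ * v * g ∈ Cz x := by
    rw [mem_Cz]
    calc g⁻¹ * v * g * x = g⁻¹ * (v * (g * x * g⁻¹)) * g := by group
      _ = g⁻¹ * ((g * x * g⁻¹) * v) * g := by rw [h1]
      _ = _ := by group
  have hnN : v⁻¹ * (g⁻¹ * v * g) ∈ N := by
    have := N.mul_mem (hNn.conj_mem _ (N.inv_mem hgN) v⁻¹) hgN
    simpa [mul_assoc] using this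
  have hnC : v⁻¹ * (g⁻¹ * v * g) ∈ Cz x := (Cz x).mul_mem ((Cz x).inv_mem hvx) hc
  have hnp : PEl p (v⁻¹ * (g⁻¹ * v * g)) := PEl.of_pgroup hN hnN
  have hcomm := H.I1 hx h hnC hvx hnp (hv.cop H.hq H.hp H.hpq.symm)
  have hcomm2 : Commute v⁻¹ (g⁻¹ * v * g) := by
    have : Commute v⁻¹ (v * (v⁻¹ * (g⁻¹ * v * g))) :=
      Commute.mul_right (Commute.refl v).inv_left hcomm.symm.inv_left
    rwa [mul_inv_cancel_left] at this
  have hnq : PEl q (v⁻¹ * (g⁻¹ * v * g)) :=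
    hv.inv.mul (by simpa using hv.conj g⁻¹) hcomm2
  have h1 := eq_one_of_PEl_two H.hp H.hq H.hpq hnp hnq
  apply hgD
  rw [mem_Cz]
  rw [inv_mul_eq_one] at h1
  calc g * v = g * (g⁻¹ * v * g) := by rw [← h1]
    _ = _ := by group

lemma I4b (H : Hyp G p q a b) {x : G} (hx : PEl p x) (h : p ∣ csize x) (h' : ¬ q ∣ csize x)
    {v : G} (hv : PEl q v) : v ∈ Cz x := by
  obtain ⟨k, hk⟩ := exists_conj_Cz H.hq h' hv.zpowers
  have hk := mem_Cz.1 (hk v (mem_zpowers v))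
  have h1 : k⁻¹ * v * k ∈ Cz x := by
    rw [mem_Cz]
    calc k⁻¹ * v * k * x = k⁻¹ * (v * (k * x * k⁻¹)) * k := by group
      _ = k⁻¹ * ((k * x * k⁻¹) * v) * k := by rw [hk]
      _ = _ := by group
  have h2 := H.I4a hx h h' (by simpa using hv.conj k⁻¹) h1
  have h3 := mem_Cz.1 (h2 (normalClosure_normal.conj_mem x (mem_nc x) k⁻¹))
  rw [mem_Cz]
  calc v * x = k * ((k⁻¹ * v * k) * (k⁻¹ * x * k⁻¹⁻¹)) * k⁻¹ := by group
    _ = k * ((k⁻¹ * x * k⁻¹⁻¹) * (k⁻¹ * v * k)) * k⁻¹ := by rw [h3]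
    _ = _ := by group

lemma I4 (H : Hyp G p q a b) {x : G} (hx : PEl p x) (h : p ∣ csize x) (h' : ¬ q ∣ csize x)
    {v w : G} (hv : PEl q v) (hw : PEl q w) : PEl q (v * w) := by
  obtain ⟨S, hS⟩ := exists_syl H.hq (⊤ : Subgroup (Cz x))
  have hSn := (lemA H.hq (G := Cz x) (fun k hk => by
    refine not_dvd_of_syl H.hq hS fun s hs => ?_
    rw [← Subgroup.orderOf_coe] at hk
    obtain ⟨u, z, hu, hz, hup, hzc, e⟩ := H.symm.decomp_q hk
    have huC : u ∈ Cz x := (Subgroup.zpowers_le.2 k.2) hu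
    have hsq : PEl q (s : G) := by
      obtain ⟨n, hn⟩ := PEl.of_pgroup hS.pgroup hs
      exact ⟨n, by simpa using congrArg Subtype.val hn⟩
    have h1 := H.I1 hx h huC s.2 hup (hsq.cop H.hq H.hp H.hpq.symm)
    have h2 : Commute (s : G) z := Subgroup.mem_center_iff.1 hzc s
    rw [mem_Cz]
    apply Subtype.ext
    simp only [Subgroup.coe_mul]
    rw [e]
    exact (h1.symm.mul_right h2)) S hS).1
  have key : ∀ v : G, (hv : PEl q v) → (⟨v, H.I4b hx h h' hv⟩ : Cz x) ∈ S := by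
    intro v hv
    have hv' : PEl q (⟨v, H.I4b hx h h' hv⟩ : Cz x) := by
      obtain ⟨k, hk⟩ := hv
      exact ⟨k, Subtype.ext hk⟩
    obtain ⟨k, _, hk⟩ := hS.conj_le H.hq le_top hv'.zpowers
    have h1 := hSn.conj_mem _ (hk _ (mem_zpowers _)) k⁻¹
    simpa [mul_assoc] using h1
  obtain ⟨n, hn⟩ := PEl.of_pgroup hS.pgroup (S.mul_mem (key v hv) (key w hw))
  exact ⟨n, by simpa using congrArg Subtype.val hn⟩

lemma sylow_normal {r : ℕ} [Fact r.Prime]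
    (h : ∀ v w : G, PEl r v → PEl r w → PEl r (v * w)) (P : Sylow r G) : P.Normal := by
  let Q : Subgroup G := { carrier := {x | PEl r x}
                          mul_mem' := fun {a b} ha hb => h a b ha hb
                          one_mem' := ⟨0, by simp⟩
                          inv_mem' := fun {x} hx => hx.inv }
  have hQ : IsPGroup r Q := by
    rintro ⟨x, k, hk⟩
    exact ⟨k, Subtype.ext hk⟩
  have hle : (P : Subgroup G) ≤ Q := fun x hx => PEl.of_pgroup P.isPGroup' hx
  have he := P.is_maximal' hQ hle
  refine ⟨fun x hx g => ?_⟩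
  have : g * x * g⁻¹ ∈ Q := (PEl.of_pgroup P.isPGroup' hx).conj g
  rw [he] at this
  exact this

lemma caseI (H : Hyp G p q a b) {x : G} (hx : PEl p x) (h : p ∣ csize x) (h' : ¬ q ∣ csize x)
    {g : G} (hg : csize g = q ^ b) : Group.IsNilpotent G := by
  obtain ⟨u, v, z, hu, hv, hup, hvq, hz, e⟩ := H.decomp3 g
  have huc : u ∈ center G := by
    refine H.I3 hx h h' hup fun hd => H.not_p_dvd_q (hg ▸ hd.trans ?_)
    exact csize_dvd (Cz_le_of_mem_zpowers hu)
  have hvs : csize v = q ^ b := by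
    rw [← hg, e, csize_central_mul huc, csize_mul_central hz]
  have hvq' : q ∣ csize v := hvs ▸ dvd_pow_self q H.hb.ne'
  have hvp' : ¬ p ∣ csize v := hvs ▸ H.not_p_dvd_q
  refine ((Group.isNilpotent_of_finite_tfae (G := G)).out 0 3).2 ?_
  intro r hr P
  by_cases hrp : r = p
  · subst hrp
    exact sylow_normal (fun v' w hv' hw => H.symm.I4 hvq hvq' hvp' hv' hw) P
  by_cases hrq : r = q
  · subst hrq
    exact sylow_normal (fun v' w hv' hw => H.I4 hx h h' hv' hw) P
  refine ⟨fun y hy g => ?_⟩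
  have hyr := PEl.of_pgroup P.isPGroup' hy
  have := H.central_coprime (hyr.cop hr.out H.hp hrp) (hyr.cop hr.out H.hq hrq)
  rw [Subgroup.mem_center_iff.1 this g, mul_inv_cancel_right]
  exact hy

end Hyp
end CamThm
set_option linter.unusedSectionVars false
namespace CamThm
open Subgroup

/-- `p`-elements whose class size is divisible by `q` but not by `p` -/
def InX {G : Type*} [Group G] (p q : ℕ) (x : G) : Prop :=
  PEl p x ∧ ¬ p ∣ csize x ∧ q ∣ csize x

/-- the second case -/
structure Hyp2 (G : Type*) [Group G] (p q a b : ℕ) : Prop extends Hyp G p q a b where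
  np : ∀ x : G, PEl p x → p ∣ csize x → q ∣ csize x
  nq : ∀ x : G, PEl q x → q ∣ csize x → p ∣ csize x
  ab : ∃ g : G, csize g = p ^ a * q ^ b

section
variable {G : Type*} [Group G] [Finite G]

lemma InX.conj {p q : ℕ} {x : G} (h : InX p q x) (g : G) : InX p q (g * x * g⁻¹) :=
  ⟨h.1.conj g, by rw [csize_conj]; exact h.2.1, by rw [csize_conj]; exact h.2.2⟩

lemma nc_le {x : G} {K : Subgroup G} (h : ∀ g : G, g * x * g⁻¹ ∈ K) : normalClosure {x} ≤ K := by
  rw [normalClosure, closure_le]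
  intro y hy
  rw [Group.mem_conjugatesOfSet_iff] at hy
  obtain ⟨x', hx', hy⟩ := hy
  rw [Set.mem_singleton_iff.1 hx'] at hy
  obtain ⟨g, rfl⟩ := isConj_iff.1 hy
  exact h g

lemma nc_comm {x w : G} (h : ∀ g : G, Commute x (g * w * g⁻¹)) {l m : G}
    (hl : l ∈ normalClosure {x}) (hm : m ∈ normalClosure {w}) : Commute l m := by
  have h1 : normalClosure {w} ≤ Cz x := nc_le fun g => mem_Cz.2 (h g).symm
  have h2 : normalClosure {x} ≤ Cz m := nc_le fun g => by
    have h3 := mem_Cz.1 (h1 (normalClosure_normal.conj_mem m hm g⁻¹))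
    rw [mem_Cz]
    calc g * x * g⁻¹ * m = g * (x * (g⁻¹ * m * g⁻¹⁻¹)) * g⁻¹ := by group
      _ = g * ((g⁻¹ * m * g⁻¹⁻¹) * x) * g⁻¹ := by rw [h3]
      _ = _ := by group
  exact mem_Cz.1 (h2 hl)

lemma lemZ {p q a b : ℕ} (H : Hyp G p q a b) {x g : G}
    (hz : ∀ t ∈ Cz x, PEl q t → t ∈ center G) (hg : q ∣ csize g) :
    ∀ t ∈ Cz g, PEl q t → t ∈ center G := by
  intro t ht htq
  obtain ⟨T, hT⟩ := exists_syl H.hq (Cz x)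
  have hTc : T ≤ center G := fun s hs => hz s (hT.1 hs) (PEl.of_pgroup hT.pgroup hs)
  have hTg : IsSyl q T (Cz g) := H.symm.syl_trans hg hT fun s hs =>
    mem_Cz.2 (Subgroup.mem_center_iff.1 (hTc hs) g).symm
  obtain ⟨h, _, hh⟩ := hTg.conj_le H.hq (T := zpowers t) (Subgroup.zpowers_le.2 ht) htq.zpowers
  have h1 := hTc (hh t (mem_zpowers t))
  have h2 := (inferInstance : (center G).Normal).conj_mem _ h1 h⁻¹
  simpa [mul_assoc] using h2

/-- fixed point in a coset -/
lemma fixed_pt {p : ℕ} (hp : p.Prime) {R Y : Subgroup G} (hR : IsPGroup p R)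
    (hY : ¬ p ∣ Nat.card Y) (hYn : Y.Normal) {w : G} (h : ∀ r ∈ R, w⁻¹ * (r * w * r⁻¹) ∈ Y) :
    ∃ η ∈ Y, ∀ r ∈ R, Commute r (w * η) := by
  have := Fact.mk hp
  let α := {c : G // w⁻¹ * c ∈ Y}
  have e : α ≃ Y :=
    { toFun := fun c => ⟨w⁻¹ * c.1, c.2⟩
      invFun := fun y => ⟨w * y.1, by simp⟩
      left_inv := fun c => by simp
      right_inv := fun y => by simp }
  let act : MulAction R α :=
    { smul := fun r c => ⟨r * c.1 * r⁻¹, by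
        have h1 := Y.mul_mem (h r r.2) (hYn.conj_mem _ c.2 r)
        have h2 : w⁻¹ * ((r : G) * w * (r : G)⁻¹) * ((r : G) * (w⁻¹ * c.1) * (r : G)⁻¹) =
          w⁻¹ * (r * c.1 * (r : G)⁻¹) := by group
        rwa [h2] at h1⟩
      one_smul := fun c => Subtype.ext (by
        change ((1 : R) : G) * c.1 * ((1 : R) : G)⁻¹ = c.1
        simp)
      mul_smul := fun r s c => Subtype.ext (by
        change ((r * s : R) : G) * c.1 * ((r * s : R) : G)⁻¹ =
          (r : G) * ((s : G) * c.1 * (s : G)⁻¹) * (r : G)⁻¹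
        simp [mul_assoc]) }
  have : Finite α := Finite.of_equiv _ e.symm
  obtain ⟨c, hc⟩ := hR.nonempty_fixed_point_of_prime_not_dvd_card α
    (by rw [Nat.card_congr e]; exact hY)
  refine ⟨w⁻¹ * c.1, c.2, fun r hr => ?_⟩
  have h1 : r * c.1 * r⁻¹ = c.1 := congrArg Subtype.val (hc ⟨r, hr⟩)
  rw [mul_inv_cancel_left]
  change r * c.1 = c.1 * r
  conv_rhs => rw [← h1]
  group

lemma not_dvd_relIndex {p : ℕ} (hp : p.Prime) {S K L : Subgroup G} (hS : S ≤ K ⊓ L)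
    (hc : Nat.card S = p ^ (Nat.card L).factorization p) : ¬ p ∣ K.relIndex L := by
  intro hd
  have h1 := PEl.card_dvd hp (IsPGroup.of_card hc) hS
  rw [hc, Nat.pow_dvd_pow_iff_le_right hp.one_lt] at h1
  have h0 : K.relIndex L ≠ 0 := Subgroup.index_ne_zero_of_finite
  have h2 : Nat.card (K ⊓ L : Subgroup G) * K.relIndex L = Nat.card L := by
    rw [← Subgroup.inf_relIndex_right, ← Subgroup.relIndex_bot_left, ← Subgroup.relIndex_bot_left]
    exact Subgroup.relIndex_mul_relIndex _ _ _ bot_le inf_le_right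
  have h3 := hp.factorization_pos_of_dvd h0 hd
  rw [← h2, Nat.factorization_mul Nat.card_pos.ne' h0, Finsupp.add_apply] at h1
  omega

end

namespace Hyp2
variable {G : Type*} [Group G] [Finite G] {p q a b : ℕ}

lemma symm (H : Hyp2 G p q a b) : Hyp2 G q p b a :=
  { H.toHyp.symm with
    np := H.nq
    nq := H.np
    ab := by obtain ⟨g, hg⟩ := H.ab; exact ⟨g, by rw [hg, mul_comm]⟩ }

lemma q_dvd (H : Hyp2 G p q a b) {x : G} (hx : PEl p x) (hc : x ∉ center G) : q ∣ csize x := by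
  by_contra h
  exact hc (H.central_of (fun h' => h (H.np x hx h')) h)

lemma not_center (H : Hyp2 G p q a b) {x : G} (h : q ∣ csize x) : x ∉ center G := by
  intro hc
  rw [(csize_eq_one_iff x).2 hc] at h
  exact H.hq.ne_one (Nat.dvd_one.1 h)

lemma F0 (H : Hyp2 G p q a b) {x w : G} (hx : InX p q x) (hw : InX q p w) (h : Commute x w)
    {l m : G} (hl : l ∈ normalClosure {x}) (hm : m ∈ normalClosure {w}) : Commute l m := by
  refine nc_comm (fun g => ?_) hl hm
  have hc : (Cz x).index.Coprime (Cz w).index := by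
    rw [← csize_eq, ← csize_eq, H.toHyp.symm.eq_p hx.2.2 hx.2.1, H.eq_p hw.2.2 hw.2.1]
    exact Nat.Coprime.pow _ _ H.cop.symm
  obtain ⟨c, hc, d, hd, rfl⟩ := coprime_factor hc g
  have h1 : d * w * d⁻¹ = w := by rw [mem_Cz.1 hd]; group
  have h2 : c * d * w * (c * d)⁻¹ = c * w * c⁻¹ := by
    calc c * d * w * (c * d)⁻¹ = c * (d * w * d⁻¹) * c⁻¹ := by group
      _ = _ := by rw [h1]
  rw [h2]
  have h3 : Commute x c := (mem_Cz.1 hc).symm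
  exact (h3.mul_right h).mul_right h3.inv_right

lemma F1 (H : Hyp2 G p q a b) {x w0 : G} (hx : InX p q x) (hw0 : InX q p w0) :
    ∃ w, InX q p w ∧ Commute x w := by
  by_contra! hno
  have h1 : ∀ t ∈ Cz x, PEl q t → t ∈ center G := by
    intro t ht htq
    by_contra hc
    have hpt := H.symm.q_dvd htq hc
    have hqt : q ∣ csize t := by
      by_contra hqt
      exact hno t ⟨htq, hqt, hpt⟩ (mem_Cz.1 ht).symm
    have h2 := Cz_mul (x := x) (y := t) (mem_Cz.1 ht).symm (hx.1.cop2 H.hp H.hq H.hpq htq)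
    have h3 := H.full_max (g := x * t) hpt hqt (h2 ▸ inf_le_right)
    obtain ⟨k, hk⟩ := exists_conj_Cz H.hq hw0.2.1 htq.zpowers
    have h4 := mem_Cz_comm.1 (hk t (mem_zpowers t))
    rw [← h3, h2] at h4
    exact hno _ (hw0.conj k) (mem_Cz.1 h4.1).symm
  have h3 : ∀ u ∈ Cz w0, PEl p u → u ∈ center G := by
    intro u hu hup
    by_contra hc
    have h4 := lemZ H.toHyp h1 (H.q_dvd hup hc) w0 (mem_Cz_comm.1 hu) hw0.1
    exact H.symm.not_center hw0.2.2 h4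
  obtain ⟨g, hg⟩ := H.ab
  have hpg : p ∣ csize g := hg ▸ Dvd.dvd.mul_right (dvd_pow_self p H.ha.ne') _
  have hqg : q ∣ csize g := hg ▸ Dvd.dvd.mul_left (dvd_pow_self q H.hb.ne') _
  obtain ⟨u, v, z, hu, hv, hup, hvq, hz, e⟩ := H.decomp3 g
  have hgg : zpowers g ≤ Cz g := Subgroup.zpowers_le.2 (mem_Cz.2 rfl)
  have huc := lemZ H.toHyp.symm h3 hpg u (hgg hu) hup
  have hvc := lemZ H.toHyp h1 hqg v (hgg hv) hvq
  refine H.not_center hqg ?_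
  rw [e]
  exact mul_mem huc (mul_mem hvc hz)

lemma F2_step1 (H : Hyp2 G p q a b) {x : G} (hx : PEl p x)
    (h : ¬ IsPGroup p (normalClosure {x})) :
    ∃ l ∈ normalClosure {x}, PEl q l ∧ p ∣ (Cz l).relIndex (normalClosure {x}) := by
  by_contra! hno
  apply h
  set L := normalClosure ({x} : Set G) with hL
  have hLn : L.Normal := normalClosure_normal
  obtain ⟨P, hP⟩ := exists_syl H.hp (⊤ : Subgroup L)
  have hPn := (lemA H.hp (G := L) (fun g hg hd => by
    rw [← Subgroup.orderOf_coe] at hg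
    obtain ⟨v, z, hv, hz, hvq, hzc, e⟩ := H.decomp_q hg
    rw [csize_sub, e, Cz_mul_central hzc] at hd
    exact hno v (Subgroup.zpowers_le.2 g.2 hv) hvq hd) P hP).1
  have hPg : IsPGroup p (P.map L.subtype) := hP.pgroup.map _
  refine hPg.to_le (nc_le fun g => ?_)
  have hgL : g * x * g⁻¹ ∈ L := hLn.conj_mem x (mem_nc x) g
  refine ⟨⟨g * x * g⁻¹, hgL⟩, ?_, rfl⟩
  have hv' : PEl p (⟨g * x * g⁻¹, hgL⟩ : L) := by
    obtain ⟨k, hk⟩ := hx.conj g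
    exact ⟨k, Subtype.ext hk⟩
  obtain ⟨k, _, hk⟩ := hP.conj_le H.hp le_top hv'.zpowers
  have h1 := hPn.conj_mem _ (hk _ (mem_zpowers _)) k⁻¹
  simpa [mul_assoc] using h1

lemma F2 (H : Hyp2 G p q a b) {x w : G} (hx : InX p q x) (hw : InX q p w) (hxw : Commute x w) :
    IsPGroup p (normalClosure {x}) ∨ IsPGroup q (normalClosure {w}) := by
  by_contra! hcon
  obtain ⟨l, hl, hlq, hpl⟩ := H.F2_step1 hx.1 hcon.1
  have hLM : ∀ l ∈ normalClosure {x}, ∀ m ∈ normalClosure {w}, Commute l m :=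
    fun l hl m hm => H.F0 hx hw hxw hl hm
  have hwM := mem_nc w
  have hLn : (normalClosure ({x} : Set G)).Normal := normalClosure_normal
  have hMn : (normalClosure ({w} : Set G)).Normal := normalClosure_normal
  set L := normalClosure ({x} : Set G) with hL
  set M := normalClosure ({w} : Set G) with hM
  obtain ⟨R, hR⟩ := exists_syl H.hp (Cz (w * l))
  have hAn : (L ⊓ M).Normal := inferInstance
  have hAc : ∀ x ∈ L ⊓ M, ∀ y ∈ L ⊓ M, x * y = y * x := fun x hx y hy => hLM x hx.1 y hy.2
  obtain ⟨Y, hYn, hYA, hYq, hYt⟩ := torsion_normal (q := q) (L ⊓ M) hAn hAc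
  have hYp : ¬ p ∣ Nat.card Y := by
    have := Fact.mk H.hq
    obtain ⟨k, hk⟩ := IsPGroup.iff_card.1 hYq
    rw [hk]
    exact fun h => H.hpq ((Nat.prime_dvd_prime_iff_eq H.hp H.hq).1 (H.hp.dvd_of_dvd_pow h))
  obtain ⟨η, hη, hηR⟩ := fixed_pt H.hp hR.pgroup hYp hYn (w := w) (fun r hr => by
    have hM1 : w⁻¹ * (r * w * r⁻¹) ∈ M := M.mul_mem (M.inv_mem hwM) (hMn.conj_mem w hwM r)
    have h1 := mem_Cz.1 (hR.1 hr)
    have h2 : w⁻¹ * (r * w * r⁻¹) = l * (r * l * r⁻¹)⁻¹ := by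
      rw [eq_mul_inv_iff_mul_eq]
      calc w⁻¹ * (r * w * r⁻¹) * (r * l * r⁻¹) = w⁻¹ * (r * (w * l)) * r⁻¹ := by group
        _ = w⁻¹ * (w * l * r) * r⁻¹ := by rw [h1]
        _ = l := by group
    have hL1 : w⁻¹ * (r * w * r⁻¹) ∈ L := by
      rw [h2]; exact L.mul_mem hl (L.inv_mem (hLn.conj_mem l hl r))
    refine hYt _ ⟨hL1, hM1⟩ ?_
    have h3 : Commute (w⁻¹ * (r * w * r⁻¹)) w := hLM _ hL1 w hwM
    have h4 : Commute w⁻¹ (r * w * r⁻¹) := by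
      have : Commute w⁻¹ (w * (w⁻¹ * (r * w * r⁻¹))) :=
        Commute.mul_right (Commute.refl w).inv_left h3.symm.inv_left
      rwa [mul_inv_cancel_left] at this
    exact hw.1.inv.mul (hw.1.conj r) h4)
  have hηL := (hYA hη).1
  have hηM := (hYA hη).2
  have hηq : PEl q η := PEl.of_pgroup hYq hη
  have hcq : PEl q (w * η) := hw.1.mul hηq (hLM η hηL w hwM).symm
  have hcM : w * η ∈ M := M.mul_mem hwM hηM
  by_cases hc : w * η ∈ center G
  · apply hcon.2
    obtain ⟨Y', hYn', _, hYq', hYt'⟩ := torsion_normal (q := q) ((L ⊓ M) ⊔ center G)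
      inferInstance (by
        intro x hx y hy
        obtain ⟨x1, hx1, x2, hx2, rfl⟩ := Subgroup.mem_sup_of_normal_left.1 hx
        obtain ⟨y1, hy1, y2, hy2, rfl⟩ := Subgroup.mem_sup_of_normal_left.1 hy
        have e1 : Commute x1 y1 := hAc x1 hx1 y1 hy1
        have e2 : ∀ g, Commute g x2 := Subgroup.mem_center_iff.1 hx2
        have e3 : ∀ g, Commute g y2 := Subgroup.mem_center_iff.1 hy2
        exact (e1.mul_right (e3 x1)).mul_left (e2 _).symm)
    refine hYq'.to_le (Subgroup.normalClosure_le_normal ?_)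
    rw [Set.singleton_subset_iff]
    refine hYt' w ?_ hw.1
    have : w = η⁻¹ * (w * η) := by
      rw [← (hLM η hηL w hwM).eq]; group
    rw [this]
    exact mul_mem (Subgroup.mem_sup_left (inv_mem (hYA hη))) (Subgroup.mem_sup_right hc)
  · have hpc := H.symm.q_dvd hcq hc
    have hRc : IsSyl p R (Cz (w * η)) := H.syl_trans hpc hR fun r hr => mem_Cz.2 (hηR r hr)
    have hLc : L ≤ Cz (w * η) := fun y hy => mem_Cz.2 (hLM y hy _ hcM)
    obtain ⟨S, hS⟩ := exists_syl H.hp L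
    obtain ⟨h, hh, hhS⟩ := hRc.conj_le H.hp (hS.1.trans hLc) hS.pgroup
    refine not_dvd_relIndex H.hp (S := S.map (MulAut.conj h).toMonoidHom) (K := Cz l) (L := L)
      ?_ ?_ hpl
    · rintro _ ⟨s, hs, rfl⟩
      have hsL : h * s * h⁻¹ ∈ L := hLn.conj_mem s (hS.1 hs) h
      have hsR := hhS s hs
      refine ⟨?_, hsL⟩
      change h * s * h⁻¹ ∈ Cz l
      rw [mem_Cz]
      change Commute _ _
      have e1 : Commute (h * s * h⁻¹) (w * l) := mem_Cz.1 (hR.1 hsR)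
      have e2 := hηR _ hsR
      have e3 := hLM _ hsL η hηM
      have e4 := e3.mul_right (e2.inv_right.mul_right e1)
      have e5 : η * ((w * η)⁻¹ * (w * l)) = l := by group
      rwa [e5] at e4
    · rw [Subgroup.card_map_of_injective (MulAut.conj h).injective, hS.2]

lemma F3 (H : Hyp2 G p q a b) {x w : G} (hx : InX p q x) (hw : InX q p w) (hxw : Commute x w)
    (hM : IsPGroup q (normalClosure {w})) {s : G} (hs : PEl p s)
    (hsM : ¬ normalClosure {w} ≤ Cz s) : InX p q s ∧ ¬ Commute s w := by
  obtain ⟨k, hk⟩ := exists_conj_Cz H.hp hx.2.1 hs.zpowers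
  have hk := hk s (mem_zpowers s)
  have hy := hx.conj k
  have hyL := normalClosure_normal.conj_mem x (mem_nc x) k
  set y := k * x * k⁻¹ with hydef
  have hMy : normalClosure {w} ≤ Cz y := fun m hm => mem_Cz.2 (H.F0 hx hw hxw hyL hm).symm
  have hsc : s ∉ center G := fun hc => hsM fun m _ => mem_Cz.2 (Subgroup.mem_center_iff.1 hc m)
  have hqs := H.q_dvd hs hsc
  have hsX : InX p q s := by
    refine ⟨hs, fun hps => hsM ?_, hqs⟩
    obtain ⟨T, hT⟩ := exists_syl H.hq (Cz s)
    have hTy : T ≤ Cz y := by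
      intro t ht
      have htq := PEl.of_pgroup hT.pgroup ht
      have h2 := Cz_mul (x := s) (y := t) (mem_Cz.1 (hT.1 ht)).symm (hs.cop2 H.hp H.hq H.hpq htq)
      have h3 := H.full_max (g := s * t) hps hqs (h2 ▸ inf_le_left)
      have h4 := mem_Cz_comm.1 hk
      rw [← h3, h2] at h4
      exact mem_Cz_comm.1 h4.2
    exact ((H.toHyp.symm.syl_trans hy.2.2 hT hTy).mem_of_normal H.hq normalClosure_normal hM
      hMy).trans hT.1
  refine ⟨hsX, fun hc => hsM fun m hm => ?_⟩
  exact mem_Cz.2 (H.F0 hsX hw hc (mem_nc s) hm).symm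

end Hyp2
end CamThm
set_option linter.unusedSectionVars false
namespace CamThm
open Subgroup

namespace Hyp2
variable {G : Type*} [Group G] [Finite G] {p q a b : ℕ}

lemma mem_cent {w s : G} : s ∈ centralizer ((normalClosure {w} : Subgroup G) : Set G) ↔
    normalClosure {w} ≤ Cz s := by
  rw [Subgroup.mem_centralizer_iff]
  exact ⟨fun h m hm => mem_Cz.2 (h m hm), fun h m hm => mem_Cz.1 (h hm)⟩

lemma cent_normal (w : G) : (centralizer ((normalClosure {w} : Subgroup G) : Set G)).Normal := by
  have : (normalClosure ({w} : Set G)).Normal := normalClosure_normal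
  infer_instance

lemma card_PM (H : Hyp2 G p q a b) {x w : G} (hx : InX p q x) (hw : InX q p w)
    (hxw : Commute x w) (hM : IsPGroup q (normalClosure {w})) {P : Subgroup G}
    (hP : IsSyl p P ⊤) :
    Nat.card (P ⊓ centralizer ((normalClosure {w} : Subgroup G) : Set G) : Subgroup G) =
      p ^ (Nat.card (Cz w)).factorization p := by
  apply Nat.dvd_antisymm
  · refine PEl.card_dvd H.hp (hP.pgroup.to_le inf_le_left) ?_
    intro g hg
    exact mem_Cz_comm.1 (mem_cent.1 hg.2 (mem_nc w))
  · obtain ⟨R, hR⟩ := exists_syl H.hp (Cz w)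
    obtain ⟨k, _, hk⟩ := hP.conj_le H.hp (T := R) le_top hR.pgroup
    have hcard : Nat.card (R.map (MulAut.conj k).toMonoidHom) = Nat.card R :=
      Subgroup.card_map_of_injective (MulAut.conj k).injective
    rw [← hR.2, ← hcard]
    apply Subgroup.card_dvd_of_le
    rintro _ ⟨r, hr, rfl⟩
    refine ⟨hk r hr, (cent_normal w).conj_mem r ?_ k⟩
    rw [mem_cent]
    by_contra hcon
    exact (H.F3 hx hw hxw hM (PEl.of_pgroup hR.pgroup hr) hcon).2 (mem_Cz.1 (hR.1 hr))

lemma F6 (H : Hyp2 G p q a b) {x w s w' : G} (hx : InX p q x) (hw : InX q p w)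
    (hxw : Commute x w) (hM : IsPGroup q (normalClosure {w}))
    (hs : InX p q s) (hw' : InX q p w') (hsw : Commute s w')
    (hM' : IsPGroup q (normalClosure {w'})) (hsM : ¬ normalClosure {w} ≤ Cz s) : False := by
  obtain ⟨P, hP⟩ := exists_syl H.hp (⊤ : Subgroup G)
  have c1 := H.card_PM hx hw hxw hM hP
  have c2 := H.card_PM hs hw' hsw hM' hP
  rw [← H.cz_eq hw.2.2 hw'.2.2] at c2
  have hCn := cent_normal w
  have hCn' := cent_normal w'
  set C := centralizer ((normalClosure {w} : Subgroup G) : Set G) with hC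
  set C' := centralizer ((normalClosure {w'} : Subgroup G) : Set G) with hC'
  set n := (Nat.card (Cz w)).factorization p with hn
  have hsC' : s ∈ C' := mem_cent.2 fun m hm => mem_Cz.2 (H.F0 hs hw' hsw (mem_nc s) hm).symm
  have hne : ¬ P ⊓ C' ≤ P ⊓ C := by
    intro hle
    obtain ⟨k, _, hk⟩ := hP.conj_le H.hp (T := zpowers s) le_top hs.1.zpowers
    have h1 := (hle ⟨hk s (mem_zpowers s), hCn'.conj_mem s hsC' k⟩).2
    have h2 := hCn.conj_mem _ h1 k⁻¹
    apply hsM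
    rw [← mem_cent]
    simpa [mul_assoc] using h2
  have hMM : ∀ z ∈ normalClosure {w}, z ∈ normalClosure {w'} → z ∈ center G := by
    intro z hz hz'
    by_contra hzc
    have hzq : PEl q z := PEl.of_pgroup hM hz
    have hpz := H.symm.q_dvd hzq hzc
    have hJ : (P ⊓ C) ⊔ (P ⊓ C') ≤ Cz z := by
      refine sup_le (fun g hg => ?_) (fun g hg => ?_)
      · exact mem_Cz_comm.1 (mem_cent.1 hg.2 hz)
      · exact mem_Cz_comm.1 (mem_cent.1 hg.2 hz')
    have hJP : IsPGroup p ((P ⊓ C) ⊔ (P ⊓ C') : Subgroup G) :=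
      hP.pgroup.to_le (sup_le inf_le_left inf_le_left)
    have h1 := PEl.card_dvd H.hp hJP hJ
    rw [← H.cz_eq hw.2.2 hpz, ← hn, ← c1] at h1
    have h2 : P ⊓ C = (P ⊓ C) ⊔ (P ⊓ C') :=
      Subgroup.eq_of_le_of_card_ge le_sup_left (Nat.le_of_dvd Nat.card_pos h1)
    exact hne (h2 ▸ le_sup_right)
  obtain ⟨R, hR⟩ := exists_syl H.hp (Cz (w * w'))
  have hRle : ¬ R ≤ C := by
    intro hle
    obtain ⟨k, _, hk⟩ := hP.conj_le H.hp (T := R) le_top hR.pgroup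
    have h1 : R.map (MulAut.conj k).toMonoidHom ≤ (P ⊓ C) ⊓ (P ⊓ C') := by
      rintro _ ⟨r, hr, rfl⟩
      have e1 : Commute r w := (mem_Cz.1 (mem_cent.1 (hle hr) (mem_nc w))).symm
      have e2 : Commute r (w * w') := mem_Cz.1 (hR.1 hr)
      have e3 : Commute r w' := by
        have := e1.inv_right.mul_right e2
        rwa [inv_mul_cancel_left] at this
      have e4 : r ∈ C' := by
        rw [hC', mem_cent]
        by_contra hcon
        exact (H.F3 hs hw' hsw hM' (PEl.of_pgroup hR.pgroup hr) hcon).2 e3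
      exact ⟨⟨hk r hr, hCn.conj_mem r (hle hr) k⟩, ⟨hk r hr, hCn'.conj_mem r e4 k⟩⟩
    have h2 := Nat.le_of_dvd Nat.card_pos (Subgroup.card_dvd_of_le h1)
    rw [Subgroup.card_map_of_injective (MulAut.conj k).injective, hR.2] at h2
    have h3 : p ^ n ≤ p ^ (Nat.card (Cz (w * w'))).factorization p :=
      Nat.pow_le_pow_right H.hp.pos (H.cz_le hw.2.2 _)
    have h4 : (P ⊓ C) ⊓ (P ⊓ C') = P ⊓ C' :=
      Subgroup.eq_of_le_of_card_ge inf_le_right (by rw [c2]; exact h3.trans h2)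
    exact hne (h4 ▸ inf_le_left)
  obtain ⟨r, hr, hrC⟩ := SetLike.not_le_iff_exists.1 hRle
  have hrp : PEl p r := PEl.of_pgroup hR.pgroup hr
  have hrw := (H.F3 hx hw hxw hM hrp (fun h => hrC (mem_cent.2 h))).2
  have hMn : (normalClosure ({w} : Set G)).Normal := normalClosure_normal
  have hMn' : (normalClosure ({w'} : Set G)).Normal := normalClosure_normal
  have hz1 : w⁻¹ * (r * w * r⁻¹) ∈ normalClosure {w} :=
    mul_mem (inv_mem (mem_nc w)) (hMn.conj_mem w (mem_nc w) r)
  have hz2 : w⁻¹ * (r * w * r⁻¹) ∈ normalClosure {w'} := by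
    have h1 := mem_Cz.1 (hR.1 hr)
    have h2 : w⁻¹ * (r * w * r⁻¹) = w' * (r * w' * r⁻¹)⁻¹ := by
      rw [eq_mul_inv_iff_mul_eq]
      calc w⁻¹ * (r * w * r⁻¹) * (r * w' * r⁻¹) = w⁻¹ * (r * (w * w')) * r⁻¹ := by group
        _ = w⁻¹ * (w * w' * r) * r⁻¹ := by rw [h1]
        _ = w' := by group
    rw [h2]
    exact mul_mem (mem_nc w') (inv_mem (hMn'.conj_mem w' (mem_nc w') r))
  have hzc := Subgroup.mem_center_iff.1 (hMM _ hz1 hz2)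
  have hzq : PEl q (w⁻¹ * (r * w * r⁻¹)) := PEl.of_pgroup hM hz1
  have hrel : r * w = w * (w⁻¹ * (r * w * r⁻¹)) * r := by group
  set z := w⁻¹ * (r * w * r⁻¹) with hzdef
  have hpow : ∀ k : ℕ, r ^ k * w = w * z ^ k * r ^ k := by
    intro k
    induction k with
    | zero => simp
    | succ k ih =>
      have hzk : r * z ^ k = z ^ k * r := ((show Commute r z from hzc r).pow_right k).eq
      calc r ^ (k + 1) * w = r * (r ^ k * w) := by rw [pow_succ']; group
        _ = r * w * z ^ k * r ^ k := by rw [ih]; group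
        _ = w * z * (r * z ^ k) * r ^ k := by rw [hrel]; simp only [mul_assoc]
        _ = w * (z * z ^ k) * (r * r ^ k) := by rw [hzk]; simp only [mul_assoc]
        _ = _ := by rw [← pow_succ', ← pow_succ']
  obtain ⟨k, hk⟩ := hrp
  have h1 := hpow (p ^ k)
  rw [hk, one_mul, mul_one] at h1
  have hz0 : z = 1 := eq_one_of_PEl_two H.hp H.hq H.hpq ⟨k, (mul_eq_left.1 h1.symm)⟩ hzq
  rw [hz0, mul_one] at hrel
  exact hrw hrel

lemma main_q (H : Hyp2 G p q a b) {x w : G} (hx : InX p q x) (hw : InX q p w)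
    (hxw : Commute x w) (hM : IsPGroup q (normalClosure {w})) : False := by
  obtain ⟨P, hP⟩ := exists_syl H.hp (⊤ : Subgroup G)
  have : ∃ s ∈ P, ¬ normalClosure {w} ≤ Cz s := by
    by_contra! hno
    exact not_dvd_of_syl H.hp hP (y := w) (fun s hs => mem_Cz_comm.1 (hno s hs (mem_nc w))) hw.2.2
  obtain ⟨s, hsP, hsM⟩ := this
  have hsX := (H.F3 hx hw hxw hM (PEl.of_pgroup hP.pgroup hsP) hsM).1
  obtain ⟨w', hw', hsw⟩ := H.F1 hsX hw
  rcases H.F2 hsX hw' hsw with h | h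
  · apply hsM
    intro m hm
    have hMn : (normalClosure ({w} : Set G)).Normal := normalClosure_normal
    have hSn : (normalClosure ({s} : Set G)).Normal := normalClosure_normal
    have e1 : s * m * s⁻¹ * m⁻¹ ∈ normalClosure {w} :=
      mul_mem (hMn.conj_mem m hm s) (inv_mem hm)
    have e2 : s * m * s⁻¹ * m⁻¹ ∈ normalClosure {s} := by
      have := mul_mem (mem_nc s) (hSn.conj_mem _ (inv_mem (mem_nc s)) m)
      simpa [mul_assoc] using this
    have e3 := eq_one_of_PEl_two H.hp H.hq H.hpq (PEl.of_pgroup h e2) (PEl.of_pgroup hM e1)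
    rw [mem_Cz]
    rw [mul_inv_eq_one, mul_inv_eq_iff_eq_mul] at e3
    exact e3.symm
  · exact H.F6 hx hw hxw hM hsX hw' hsw h hsM

lemma exX (H : Hyp2 G p q a b) {g : G} (hg : csize g = q ^ b) : ∃ x : G, InX p q x := by
  obtain ⟨u, v, z, hu, hv, hup, hvq, hz, e⟩ := H.decomp3 g
  have hvp : ¬ p ∣ csize v := fun hd =>
    H.not_p_dvd_q (hg ▸ hd.trans (csize_dvd (Cz_le_of_mem_zpowers hv)))
  have hvc : v ∈ center G := H.central_of hvp fun h => hvp (H.nq v hvq h)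
  have hus : csize u = q ^ b := by
    rw [← hg, e, csize_mul_central (mul_mem hvc hz)]
  exact ⟨u, hup, hus ▸ H.not_p_dvd_q, hus ▸ dvd_pow_self q H.hb.ne'⟩

lemma contra (H : Hyp2 G p q a b) {g h : G} (hg : csize g = q ^ b) (hh : csize h = p ^ a) :
    False := by
  obtain ⟨x, hx⟩ := H.exX hg
  obtain ⟨w0, hw0⟩ := H.symm.exX hh
  obtain ⟨w, hw, hxw⟩ := H.F1 hx hw0
  rcases H.F2 hx hw hxw with h1 | h1
  · exact H.symm.main_q hw hx hxw.symm h1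
  · exact H.main_q hx hw hxw h1

end Hyp2
end CamThm

theorem stmt_10 {G : Type*} [Group G] [Finite G] (p q : ℕ) (hp : p.Prime) (hq : q.Prime)
    (hpq : p ≠ q) (a b : ℕ) (ha : 0 < a) (hb : 0 < b)
    (hsizes : ∀ x : G, csize x = 1 ∨ csize x = p ^ a ∨ csize x = q ^ b ∨ csize x = p ^ a * q ^ b)
    (h1 : ∃ x : G, csize x = p ^ a) (h2 : ∃ x : G, csize x = q ^ b)
    (h3 : ∃ x : G, csize x = p ^ a * q ^ b) :
    Group.IsNilpotent G := by
  have H : CamThm.Hyp G p q a b := ⟨hp, hq, hpq, ha, hb, hsizes⟩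
  obtain ⟨g, hg⟩ := h1
  obtain ⟨g', hg'⟩ := h2
  by_cases hA : ∀ x : G, CamThm.PEl p x → p ∣ csize x → q ∣ csize x
  · by_cases hB : ∀ x : G, CamThm.PEl q x → q ∣ csize x → p ∣ csize x
    · have H2 : CamThm.Hyp2 G p q a b := { H with np := hA, nq := hB, ab := h3 }
      exact (H2.contra hg' hg).elim
    · push Not at hB
      obtain ⟨x, hx, hx1, hx2⟩ := hB
      exact H.symm.caseI hx hx1 hx2 hg
  · push Not at hA
    obtain ⟨x, hx, hx1, hx2⟩ := hA
    exact H.caseI hx hx1 hx2 hg'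
end

section
/- Let G be a finite group acting fixed-point-freely on a nontrivial finite group A, and suppose p is an odd prime. Then the Sylow p-subgroups of G are cyclic. -/
lemma aux_norm {B : Type*} [CommGroup B] [Finite B] (f : MulAut B) (p : ℕ) (hp : f ^ p = 1)
    (hf : ∀ b, f b = b → b = 1) (b : B) : ∏ k ∈ Finset.range p, (f ^ k) b = 1 := by
  have hφ : MonoidHom.FixedPointFree f := hf
  have hit : ∀ k : ℕ, (⇑f)^[k] = ⇑(f ^ k) := by
    intro k
    induction k with
    | zero => rfl
    | succ k ih => rw [Function.iterate_succ, ih, pow_succ]; rfl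
  have h := hφ.prod_pow_eq_one (n := p) (by rw [hit, hp]; rfl) b
  simp only [hit] at h
  rw [← h]
  rfl

lemma aux_ab {G B : Type*} [Group G] [CommGroup B] [Finite B] (φ : G →* MulAut B)
    (hfree : ∀ g : G, g ≠ 1 → ∀ a : B, φ g a = a → a = 1) {p : ℕ} [hp : Fact p.Prime]
    (u v : G) (huv : Commute u v) (hu : u ^ p = 1) (hv : v ^ p = 1) (hu1 : u ≠ 1)
    (hvu : v ∉ Subgroup.zpowers u) (b : B) : b ^ p = 1 := by
  have hord : orderOf u = p := orderOf_eq_prime hu hu1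
  have key : ∀ g : G, g ≠ 1 → g ^ p = 1 → ∀ b, ∏ k ∈ Finset.range p, φ (g ^ k) b = 1 := by
    intro g hg hgp b
    have := aux_norm (φ g) p (by rw [← map_pow, hgp, map_one]) (hfree g hg) b
    simpa only [map_pow] using this
  have h1 : ∏ i ∈ Finset.range p, ∏ k ∈ Finset.range p, φ ((u ^ i * v) ^ k) b = 1 := by
    refine Finset.prod_eq_one fun i _ => key _ ?_ ?_ b
    · intro h
      apply hvu
      rw [← inv_eq_of_mul_eq_one_right h]
      exact inv_mem (pow_mem (Subgroup.mem_zpowers u) i)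
    · rw [(huv.pow_left i).mul_pow, hv, ← pow_mul, mul_comm, pow_mul, hu, one_pow, one_mul]
  rw [Finset.prod_comm] at h1
  rw [Finset.prod_eq_single_of_mem 0 (Finset.mem_range.2 hp.out.pos)] at h1
  · simpa using h1
  · intro k hk hk0
    have hk' : u ^ k ≠ 1 := by
      intro h
      have := Nat.le_of_dvd (Nat.pos_of_ne_zero hk0) (orderOf_dvd_of_pow_eq_one h)
      have := Finset.mem_range.1 hk
      omega
    have := key (u ^ k) hk' (by rw [← pow_mul, mul_comm, pow_mul, hu, one_pow]) (φ (v ^ k) b)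
    rw [← this]
    refine Finset.prod_congr rfl fun i _ => ?_
    rw [(huv.pow_left i).mul_pow, map_mul, ← pow_mul, ← pow_mul, mul_comm i k]
    rfl

lemma aux_restrict {A G : Type*} [Group A] [Group G] (φ : G →* MulAut A) (B : Subgroup A)
    (h : ∀ g, ∀ b ∈ B, φ g b ∈ B) : ∃ ψ : G →* MulAut B, ∀ g b, (ψ g b : A) = φ g b := by
  refine ⟨MonoidHom.mk' (fun g =>
    { toFun := fun b => ⟨φ g b, h g b b.2⟩
      invFun := fun b => ⟨φ g⁻¹ b, h g⁻¹ b b.2⟩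
      left_inv := fun b => by ext; simp
      right_inv := fun b => by ext; simp
      map_mul' := fun a b => by ext; simp }) ?_, ?_⟩
  · intro a b
    ext x
    simp
  · intro g b
    rfl

open scoped Pointwise in
lemma aux_unique_s18 {A G : Type*} [Group A] [Group G] [Finite A] [Finite G] [Nontrivial A]
    (φ : G →* MulAut A)
    (hfree : ∀ g : G, g ≠ 1 → ∀ a : A, φ g a = a → a = 1)
    {p : ℕ} [hp : Fact p.Prime] (hG : IsPGroup p G)
    (u v : G) (huv : Commute u v) (hu : u ^ p = 1) (hv : v ^ p = 1) (hu1 : u ≠ 1) :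
    v ∈ Subgroup.zpowers u := by
  by_contra hvu
  let : MulDistribMulAction G A := MulDistribMulAction.compHom A φ
  have hsm : ∀ (g : G) (a : A), g • a = φ g a := fun _ _ => rfl
  have hpA : ¬ p ∣ Nat.card A := by
    intro h
    obtain ⟨b, hb, hb1⟩ := hG.exists_fixed_point_of_prime_dvd_card_of_fixed_point A h
      (a := 1) (fun g => smul_one g)
    exact hb1 (hfree u hu1 b (hb u)).symm
  obtain ⟨q, hq, hqA⟩ := Nat.exists_prime_and_dvd (Finite.one_lt_card (α := A)).ne'
  have : Fact q.Prime := ⟨hq⟩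
  have hS : ¬ p ∣ Nat.card (Sylow q A) := by
    intro h
    exact hpA (h.trans ((Sylow.card_dvd_index default).trans (Subgroup.index_dvd_card _)))
  obtain ⟨Q, hQ⟩ := hG.nonempty_fixed_point_of_prime_not_dvd_card (Sylow q A) hS
  have hQinv : ∀ g, ∀ b ∈ (Q : Subgroup A), φ g b ∈ (Q : Subgroup A) := by
    intro g b hb
    have h1 : g • (Q : Subgroup A) = Q := by
      rw [← Sylow.pointwise_smul_def, hQ g]
    have h2 := Subgroup.smul_mem_pointwise_smul b g (Q : Subgroup A) hb
    rw [h1] at h2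
    exact h2
  obtain ⟨ψ, hψ⟩ := aux_restrict φ (Q : Subgroup A) hQinv
  have hcinv : ∀ g, ∀ b ∈ Subgroup.center (Q : Subgroup A), ψ g b ∈ Subgroup.center (Q : Subgroup A) := by
    intro g b hb
    rw [Subgroup.mem_center_iff] at hb ⊢
    intro x
    have := congrArg (ψ g) (hb ((ψ g).symm x))
    simpa using this
  obtain ⟨χ, hχ⟩ := aux_restrict ψ (Subgroup.center (Q : Subgroup A)) hcinv
  have : Nontrivial (Q : Subgroup A) := by
    rw [Subgroup.nontrivial_iff_ne_bot]
    exact Q.ne_bot_of_dvd_card hqA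
  have : Nontrivial (Subgroup.center (Q : Subgroup A)) := Q.isPGroup'.center_nontrivial
  obtain ⟨b, hb⟩ := exists_ne (1 : Subgroup.center (Q : Subgroup A))
  have hbp : b ^ p = 1 := by
    let : CommGroup (Subgroup.center (Q : Subgroup A)) :=
      { (inferInstance : Group (Subgroup.center (Q : Subgroup A))) with
        mul_comm := fun a b => Subtype.ext (Subgroup.mem_center_iff.1 b.2 a) }
    refine aux_ab χ ?_ u v huv hu hv hu1 hvu b
    intro g hg a ha
    ext
    refine hfree g hg _ ?_
    rw [← hψ, ← hχ, ha]
  have ho : orderOf b = p := orderOf_eq_prime hbp hb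
  apply hpA
  rw [← ho]
  exact (orderOf_dvd_natCard b).trans
    ((Subgroup.card_subgroup_dvd_card _).trans (Subgroup.card_subgroup_dvd_card _))

lemma aux_pow {P : Type*} [Group P] (x y c : P) (hc : ∀ z, Commute c z)
    (hyx : y * x = x * y * c) : ∀ n : ℕ, (x * y) ^ n = x ^ n * y ^ n * c ^ (n * (n - 1) / 2) := by
  have h1 : ∀ n : ℕ, y ^ n * x = x * y ^ n * c ^ n := by
    intro n
    induction n with
    | zero => simp
    | succ n ih =>
      rw [pow_succ y, mul_assoc, hyx, mul_assoc x y c, ← mul_assoc, ih, pow_succ' c]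
      simp only [mul_assoc]
      congr 2
      rw [← mul_assoc (c ^ n) y c, ((hc y).pow_left n).eq, mul_assoc, ← pow_succ, ← pow_succ']
  intro n
  induction n with
  | zero => simp
  | succ n ih =>
    have e : (n + 1) * (n + 1 - 1) / 2 = n + n * (n - 1) / 2 := by
      rw [← Finset.sum_range_id_mul_two, ← Finset.sum_range_id_mul_two]
      rw [Nat.mul_div_cancel _ two_pos, Nat.mul_div_cancel _ two_pos, Finset.sum_range_succ,
        add_comm]
    rw [e, pow_succ (x * y), ih, pow_add c]
    set m := n * (n - 1) / 2
    have h2 := ((hc (x * y)).pow_left m).eq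
    rw [mul_assoc, h2, mul_assoc (x ^ n), ← mul_assoc (y ^ n), ← mul_assoc (y ^ n), h1 n]
    simp only [mul_assoc]
    rw [← mul_assoc (c ^ n) y, ((hc y).pow_left n).eq, pow_succ x, pow_succ y]
    simp only [mul_assoc]

lemma aux_index {P : Type*} [Group P] [Finite P] {p : ℕ} [hp : Fact p.Prime] {n : ℕ}
    (hc : Nat.card P = p ^ (n + 1)) (M : Subgroup P) (hM : Nat.card M = p ^ n) :
    (∀ x : P, x ^ p ∈ M) ∧ (∀ x y : P, x * y * x⁻¹ * y⁻¹ ∈ M) ∧ (∀ K, M < K → K = ⊤) := by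
  have hi : M.index = p := by
    have := M.card_mul_index
    rw [hM, hc, pow_succ] at this
    exact Nat.eq_of_mul_eq_mul_left (pow_pos hp.out.pos n) this
  have : M.Normal := by
    apply Subgroup.normal_of_index_eq_minFac_card
    rw [hi, hc, hp.out.pow_minFac (Nat.succ_ne_zero n)]
  refine ⟨fun x => ?_, ?_, ?_⟩
  · have := M.pow_index_mem x
    rwa [hi] at this
  · intro x y
    have : IsCyclic (P ⧸ M) := isCyclic_of_prime_card (p := p) hi
    rw [← QuotientGroup.eq_one_iff]
    have := (IsCyclic.isMulCommutative (α := P ⧸ M)).is_comm.comm (x : P ⧸ M) (y : P ⧸ M)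
    change ((x : P ⧸ M) * y * (x : P ⧸ M)⁻¹ * (y : P ⧸ M)⁻¹) = 1
    rw [this]
    group
  · intro K hK
    have h := Subgroup.relIndex_mul_index hK.le
    rw [hi] at h
    rcases (Nat.dvd_prime hp.out).1 (Dvd.intro_left _ h) with h1 | h1
    · exact Subgroup.index_eq_one.1 h1
    · rw [h1] at h
      have h2 : M.relIndex K = 1 := Nat.eq_of_mul_eq_mul_right hp.out.pos (by rw [h, one_mul])
      exact absurd (Subgroup.relIndex_eq_one.1 h2) hK.not_ge

lemma aux_cyclic {p : ℕ} [hp : Fact p.Prime] (hodd : Odd p) : ∀ (n : ℕ) {P : Type*} [Group P] [Finite P],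
    Nat.card P = p ^ n →
    (∀ u v : P, Commute u v → u ^ p = 1 → v ^ p = 1 → u ≠ 1 → v ∈ Subgroup.zpowers u) →
    IsCyclic P := by
  intro n
  induction n with
  | zero =>
    intro P _ _ hc _
    have : Subsingleton P := (Nat.card_eq_one_iff_unique.1 (by simpa using hc)).1
    infer_instance
  | succ n ih =>
    intro P _ _ hc hP
    by_contra hcyc
    have hsub : ∀ M : Subgroup P, Nat.card M = p ^ n → ∀ x ∈ M, ∀ y ∈ M, Commute x y := by
      intro M hM x hx y hy
      have hMc : IsCyclic M := by
        refine ih hM ?_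
        intro u v huv hu hv hu1
        have := hP u v (congrArg Subtype.val huv.eq)
          (by simpa using congrArg Subtype.val hu) (by simpa using congrArg Subtype.val hv)
          (by simpa using hu1)
        obtain ⟨k, hk⟩ := this
        exact ⟨k, by ext; simpa using hk⟩
      have := (IsCyclic.isMulCommutative (α := M)).is_comm.comm ⟨x, hx⟩ ⟨y, hy⟩
      exact congrArg Subtype.val this
    have hpg : IsPGroup p P := IsPGroup.of_card hc
    have hdvd : p ^ n ∣ Nat.card P := hc ▸ pow_dvd_pow p (Nat.le_succ n)
    have hlt : p ^ n < p ^ (n + 1) := Nat.pow_lt_pow_right hp.out.one_lt (Nat.lt_succ_self n)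
    obtain ⟨M, hM⟩ := Sylow.exists_subgroup_card_pow_prime p hdvd
    obtain ⟨y, hy⟩ : ∃ y, y ∉ M := by
      by_contra! h
      have : M = ⊤ := (Subgroup.eq_top_iff' M).2 h
      rw [this, Subgroup.card_top, hc] at hM
      omega
    obtain ⟨m, hm⟩ := (hpg.to_subgroup (Subgroup.zpowers y)).exists_card_eq
    have hmn : m ≤ n := by
      have h1 : p ^ m ∣ p ^ (n + 1) := by
        rw [← hm, ← hc]; exact Subgroup.card_subgroup_dvd_card _
      have h2 := (Nat.pow_dvd_pow_iff_le_right hp.out.one_lt).1 h1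
      by_contra h3
      have h4 : m = n + 1 := by omega
      apply hcyc
      have h5 : Subgroup.zpowers y = ⊤ := Subgroup.eq_top_of_card_eq _ (by rw [hm, hc, h4])
      exact ⟨y, fun x => by
        change x ∈ Subgroup.zpowers y
        rw [h5]; trivial⟩
    obtain ⟨N, hN, hyN⟩ := Sylow.exists_subgroup_card_pow_prime_le p hdvd _ hm hmn
    have hyN' : y ∈ N := hyN (Subgroup.mem_zpowers y)
    obtain ⟨hM1, hM2, hM3⟩ := aux_index hc M hM
    obtain ⟨hN1, hN2, hN3⟩ := aux_index hc N hN
    have hcent : ∀ z ∈ M, z ∈ N → ∀ x, Commute z x := by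
      intro z hzM hzN x
      have h1 : M ≤ Subgroup.centralizer {z} := fun w hw =>
        Subgroup.mem_centralizer_singleton_iff.2 (hsub M hM _ hw _ hzM).eq
      have h2 : y ∈ Subgroup.centralizer {z} :=
        Subgroup.mem_centralizer_singleton_iff.2 (hsub N hN _ hyN' _ hzN).eq
      have h3 : Subgroup.centralizer {z} = ⊤ :=
        hM3 _ (lt_of_le_of_ne h1 (fun h => hy (h ▸ h2)))
      have h4 : x ∈ Subgroup.centralizer {z} := by rw [h3]; trivial
      exact (Subgroup.mem_centralizer_singleton_iff.1 h4).symm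
    have hpow : ∀ x y : P, (x * y) ^ p = x ^ p * y ^ p := by
      intro x y
      set c := y⁻¹ * x⁻¹ * y * x with hcdef
      have hcc : ∀ z, Commute c z := hcent c (by simpa using hM2 y⁻¹ x⁻¹) (by simpa using hN2 y⁻¹ x⁻¹)
      have hcom : y * x = x * y * c := by
        rw [hcdef]
        group
      have hcp : c ^ p = 1 := by
        have h1 : ∀ n : ℕ, y ^ n * x = x * y ^ n * c ^ n := by
          intro n
          have h2 : x⁻¹ * y * x = y * c := by rw [mul_assoc, hcom]; group
          have h3 : x⁻¹ * y ^ n * x = y ^ n * c ^ n := by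
            rw [← (hcc y).symm.mul_pow, ← h2]
            simpa using (conj_pow (i := n) (a := x⁻¹) (b := y)).symm
          rw [mul_assoc, ← h3]; group
        have h2 := h1 p
        rw [(hcent (y ^ p) (hM1 y) (hN1 y) x).eq] at h2
        exact (mul_eq_left.1 h2.symm)
      rw [aux_pow x y c hcc hcom p]
      have : p ∣ p * (p - 1) / 2 := by
        obtain ⟨k, hk⟩ := hodd
        refine ⟨k, ?_⟩
        have : p * (p - 1) = p * k * 2 := by
          rw [show p - 1 = k * 2 by omega, mul_assoc]
        rw [this, Nat.mul_div_cancel _ two_pos]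
      obtain ⟨k, hk⟩ := this
      rw [hk, pow_mul, hcp, one_pow, mul_one]
    let f : P →* P := ⟨⟨fun x => x ^ p, one_pow p⟩, hpow⟩
    have hrange : f.range ≤ N ⊓ M := by
      rintro _ ⟨x, rfl⟩
      exact ⟨hN1 x, hM1 x⟩
    have : Nontrivial P := by
      rw [← Finite.one_lt_card_iff_nontrivial, hc]
      exact Nat.one_lt_pow (Nat.succ_ne_zero n) hp.out.one_lt
    have := hpg.center_nontrivial
    have hpc : p ∣ Nat.card (Subgroup.center P) := by
      obtain ⟨k, hk0, hk⟩ := (hpg.to_subgroup (Subgroup.center P)).nontrivial_iff_card.1 this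
      rw [hk]
      exact dvd_pow_self p hk0.ne'
    obtain ⟨u, hu⟩ := exists_prime_orderOf_dvd_card' p hpc
    have hu' : orderOf (u : P) = p := by rw [Subgroup.orderOf_coe, hu]
    have hker : f.ker ≤ Subgroup.zpowers (u : P) := by
      intro v hv
      refine hP u v (Subgroup.mem_center_iff.1 u.2 v).symm ?_ hv ?_
      · rw [← hu']; exact pow_orderOf_eq_one _
      · intro h
        rw [h, orderOf_one] at hu'
        exact hp.out.one_lt.ne hu'
    have hkc : Nat.card f.ker ≤ p := by
      have := Nat.card_mono (Set.toFinite _) hker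
      rw [SetLike.coe_sort_coe, SetLike.coe_sort_coe, Nat.card_zpowers, hu'] at this
      exact this
    have hrc : Nat.card f.range < p ^ n := by
      rw [← hN]
      refine lt_of_le_of_ne (Nat.card_mono (Set.toFinite _) (hrange.trans inf_le_left)) ?_
      intro h
      have := Subgroup.eq_of_le_of_card_ge (hrange.trans inf_le_left) h.ge
      exact hy (hrange (this ▸ hyN')).2
    have htot : Nat.card f.range * Nat.card f.ker = p ^ (n + 1) := by
      rw [← hc, ← Subgroup.index_ker, mul_comm]
      exact f.ker.card_mul_index
    have : Nat.card f.range * Nat.card f.ker < p ^ n * p :=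
      lt_of_le_of_lt (Nat.mul_le_mul_left _ hkc) (Nat.mul_lt_mul_of_pos_right hrc hp.out.pos)
    rw [htot, pow_succ] at this
    exact lt_irrefl _ this

theorem stmt_18 {A G : Type*} [Group A] [Group G] [Finite A] [Finite G] [Nontrivial A]
    (φ : G →* MulAut A)
    (hfree : ∀ g : G, g ≠ 1 → ∀ a : A, φ g a = a → a = 1)
    {p : ℕ} [Fact p.Prime] (hodd : Odd p) (hpG : p ∣ Nat.card G) :
    ∀ P : Sylow p G, IsCyclic (P : Subgroup G) := by
  intro P
  obtain ⟨n, hn⟩ := P.isPGroup'.exists_card_eq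
  refine aux_cyclic hodd n hn ?_
  intro u v huv hu hv hu1
  refine aux_unique_s18 (φ.comp (P : Subgroup G).subtype) ?_ P.isPGroup' u v huv hu hv hu1
  intro g hg a ha
  exact hfree g (by simpa using hg) a ha
end
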